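/- arXiv:math/0003037 — 3 statements merged into one kernel-verified Lean document; each statement's English description precedes it below -/
import Mathlib

section
/- Let z = (τ0, x0) and z' = (τ0', x0') be distinct points of M with τ0 ≤ τ0' and ∫_{τ0}^{τ0'} f(τ)^{−1} dτ ≥ |x0' − x0| (i.e. z and z' are causally related). Then there exists exactly one geodesic γ : [0,1] → M with γ(0) = z and γ(1) = z'; this geodesic is causal — timelike if the inequality is strict and lightlike if equality holds. In particular, no spacelike geodesic joins z and z'. -/
open Set Filter MeasureTheory Topology
open scoped ENNReal NNReal

noncomputable section

namespace GRW

/-- The open interval `(a,b)` (extended-real endpoints) as a subset of `ℝ`. -/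
def II (aE bE : EReal) : Set ℝ := {τ : ℝ | aE < (τ : EReal) ∧ (τ : EReal) < bE}

/-- `G = 1/f²`. -/
def G (f : ℝ → ℝ) (τ : ℝ) : ℝ := ((f τ) ^ 2)⁻¹

/-- The nonnegative integrand `f⁻² (G − D)^{-1/2}`, valued in `[0,∞]`. -/
def h (f : ℝ → ℝ) (D τ : ℝ) : ℝ≥0∞ :=
  ENNReal.ofReal ((f τ ^ 2 * Real.sqrt (G f τ - D))⁻¹)

/-- A geodesic `t ↦ (σ t, x t)` of `g^f = -dτ² + f(τ)² dx²` defined on `[t0, t1]`,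
with values in the spacetime `(a,b) × J`. -/
structure IsGeodesicOn (aE bE : EReal) (f : ℝ → ℝ) (J : Set ℝ)
    (σ x : ℝ → ℝ) (t0 t1 : ℝ) : Prop where
  mem_base : ∀ t ∈ Icc t0 t1, σ t ∈ II aE bE
  mem_fiber : ∀ t ∈ Icc t0 t1, x t ∈ J
  smooth_base : ContDiffOn ℝ 2 σ (Icc t0 t1)
  smooth_fiber : ContDiffOn ℝ 2 x (Icc t0 t1)
  eq_base : ∀ t ∈ Icc t0 t1,
    derivWithin (derivWithin σ (Icc t0 t1)) (Icc t0 t1) t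
      = -(f (σ t) * deriv f (σ t) * (derivWithin x (Icc t0 t1) t) ^ 2)
  eq_fiber : ∀ t ∈ Icc t0 t1,
    derivWithin (derivWithin x (Icc t0 t1)) (Icc t0 t1) t
      = -(2 * (deriv f (σ t) / f (σ t)) * derivWithin σ (Icc t0 t1) t
          * derivWithin x (Icc t0 t1) t)

/-- The energy `-(τ')² + f(τ)² (x')²` of a curve `(σ, x)` parameterized on `[t0,t1]`. -/
def energyW (f σ x : ℝ → ℝ) (t0 t1 t : ℝ) : ℝ :=
  -(derivWithin σ (Icc t0 t1) t) ^ 2 + (f (σ t)) ^ 2 * (derivWithin x (Icc t0 t1) t) ^ 2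

/-- The velocity of a curve `(σ, x)` parameterized on `[t0,t1]`. -/
def velW (σ x : ℝ → ℝ) (t0 t1 t : ℝ) : ℝ × ℝ :=
  (derivWithin σ (Icc t0 t1) t, derivWithin x (Icc t0 t1) t)

/-- Geodesic connectedness of the GRW spacetime `(a,b) × J`. -/
def GeodConnected (aE bE : EReal) (f : ℝ → ℝ) (J : Set ℝ) : Prop :=
  ∀ τ0 x0 τ0' x0' : ℝ, τ0 ∈ II aE bE → x0 ∈ J → τ0' ∈ II aE bE → x0' ∈ J →
    ∃ (σ x : ℝ → ℝ) (t1 : ℝ), 0 ≤ t1 ∧ IsGeodesicOn aE bE f J σ x 0 t1 ∧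
      σ 0 = τ0 ∧ x 0 = x0 ∧ σ t1 = τ0' ∧ x t1 = x0'

/-- Two points are related by a piecewise-`C¹` curve in the spacetime all of whose pieces
satisfy the pointwise condition `P` on (energy density, velocity). -/
def RelatedVia (aE bE : EReal) (f : ℝ → ℝ) (J : Set ℝ)
    (P : ℝ → ℝ × ℝ → Prop) (z z' : ℝ × ℝ) : Prop :=
  ∃ (n : ℕ) (s : ℕ → ℝ) (σ x : ℝ → ℝ),
    s 0 = 0 ∧ s (n + 1) = 1 ∧ (∀ i ≤ n, s i < s (i + 1)) ∧
    σ 0 = z.1 ∧ x 0 = z.2 ∧ σ 1 = z'.1 ∧ x 1 = z'.2 ∧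
    (∀ t ∈ Icc (0:ℝ) 1, σ t ∈ II aE bE ∧ x t ∈ J) ∧
    ContinuousOn σ (Icc 0 1) ∧ ContinuousOn x (Icc 0 1) ∧
    ∀ i ≤ n, ContDiffOn ℝ 1 σ (Icc (s i) (s (i + 1))) ∧
      ContDiffOn ℝ 1 x (Icc (s i) (s (i + 1))) ∧
      ∀ t ∈ Icc (s i) (s (i + 1)),
        P (energyW f σ x (s i) (s (i + 1)) t) (velW σ x (s i) (s (i + 1)) t)

/-- Timelike related: joined by a piecewise smooth timelike curve. -/
def TimelikeRel (aE bE : EReal) (f : ℝ → ℝ) (J : Set ℝ) (z z' : ℝ × ℝ) : Prop :=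
  RelatedVia aE bE f J (fun q _ => q < 0) z z'

/-- Spacelike related: joined by a piecewise smooth spacelike curve. -/
def SpacelikeRel (aE bE : EReal) (f : ℝ → ℝ) (J : Set ℝ) (z z' : ℝ × ℝ) : Prop :=
  RelatedVia aE bE f J (fun q _ => 0 < q) z z'

/-- Lightlike related: joined by a piecewise smooth lightlike curve with
nowhere-vanishing velocity. -/
def LightlikeRel (aE bE : EReal) (f : ℝ → ℝ) (J : Set ℝ) (z z' : ℝ × ℝ) : Prop :=
  RelatedVia aE bE f J (fun q v => q = 0 ∧ v ≠ 0) z z'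

/-- The filter of approach to `b` from inside `(a,b)`. -/
def Fb (bE : EReal) : Filter ℝ := comap (fun τ : ℝ => (τ : EReal)) (𝓝[<] bE)

/-- The filter of approach to `a` from inside `(a,b)`. -/
def Fa (aE : EReal) : Filter ℝ := comap (fun τ : ℝ => (τ : EReal)) (𝓝[>] aE)

/-- `m_b = liminf_{τ→b} G(τ)`, valued in `EReal`. -/
def mB (bE : EReal) (f : ℝ → ℝ) : EReal := liminf (fun τ => (G f τ : EReal)) (Fb bE)

/-- `m_a = liminf_{τ→a} G(τ)`, valued in `EReal`. -/
def mA (aE : EReal) (f : ℝ → ℝ) : EReal := liminf (fun τ => (G f τ : EReal)) (Fa aE)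

/-- `c` witnesses that `G` reaches a relative minimum at `b`: `G > m_b` on `(c,b)`. -/
def RelMinB (aE bE : EReal) (f : ℝ → ℝ) (c : ℝ) : Prop :=
  c ∈ II aE bE ∧ ∀ τ : ℝ, c < τ → (τ : EReal) < bE → mB bE f < (G f τ : EReal)

/-- `c` witnesses that `G` reaches a relative minimum at `a`: `G > m_a` on `(a,c)`. -/
def RelMinA (aE bE : EReal) (f : ℝ → ℝ) (c : ℝ) : Prop :=
  c ∈ II aE bE ∧ ∀ τ : ℝ, τ < c → aE < (τ : EReal) → mA aE f < (G f τ : EReal)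

/-- `∫_c^b f⁻²(G−D)^{-1/2}`, valued in `[0,∞]`. -/
def IbInt (bE : EReal) (f : ℝ → ℝ) (c D : ℝ) : ℝ≥0∞ :=
  ∫⁻ τ in {τ : ℝ | c < τ ∧ (τ : EReal) < bE}, h f D τ

/-- `∫_a^c f⁻²(G−D)^{-1/2}`, valued in `[0,∞]`. -/
def IaInt (aE : EReal) (f : ℝ → ℝ) (c D : ℝ) : ℝ≥0∞ :=
  ∫⁻ τ in {τ : ℝ | aE < (τ : EReal) ∧ τ < c}, h f D τ

/-- Condition (A) at `b`. -/
def CondA_b (aE bE : EReal) (f : ℝ → ℝ) : Prop :=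
  (¬ ∃ c, RelMinB aE bE f c) ∨
  ∃ c, RelMinB aE bE f c ∧ IbInt bE f c (mB bE f).toReal = ⊤

/-- Condition (A) at `a`. -/
def CondA_a (aE bE : EReal) (f : ℝ → ℝ) : Prop :=
  (¬ ∃ c, RelMinA aE bE f c) ∨
  ∃ c, RelMinA aE bE f c ∧ IaInt aE f c (mA aE f).toReal = ⊤

/-- Condition (A). -/
def CondA (aE bE : EReal) (f : ℝ → ℝ) : Prop :=
  CondA_a aE bE f ∧ CondA_b aE bE f

/-- `b^*(D) = inf {τ ∈ (c,b) | G τ = D}`, defaulting to `b` when the set is empty. -/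
def bstar (bE : EReal) (f : ℝ → ℝ) (c D : ℝ) : EReal :=
  sInf (insert bE ((fun τ : ℝ => (τ : EReal)) ''
    {τ : ℝ | c < τ ∧ (τ : EReal) < bE ∧ G f τ = D}))

/-- `a^*(D) = sup {τ ∈ (a,c) | G τ = D}`, defaulting to `a` when the set is empty. -/
def astar (aE : EReal) (f : ℝ → ℝ) (c D : ℝ) : EReal :=
  sSup (insert aE ((fun τ : ℝ => (τ : EReal)) ''
    {τ : ℝ | τ < c ∧ aE < (τ : EReal) ∧ G f τ = D}))

/-- `∫_c^{b^*(D)} f⁻²(G−D)^{-1/2}`. -/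
def IbStar (bE : EReal) (f : ℝ → ℝ) (c D : ℝ) : ℝ≥0∞ :=
  ∫⁻ τ in {τ : ℝ | c < τ ∧ (τ : EReal) < bstar bE f c D}, h f D τ

/-- `∫_{a^*(D)}^c f⁻²(G−D)^{-1/2}`. -/
def IaStar (aE : EReal) (f : ℝ → ℝ) (c D : ℝ) : ℝ≥0∞ :=
  ∫⁻ τ in {τ : ℝ | astar aE f c D < (τ : EReal) ∧ τ < c}, h f D τ

/-- `d_b`, computed with respect to the cut point `c`. -/
def dB (bE : EReal) (f : ℝ → ℝ) (c : ℝ) : ℝ≥0∞ :=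
  limsup (fun D => IbStar bE f c D) (𝓝[>] (mB bE f).toReal) - IbInt bE f c (mB bE f).toReal

/-- `d_a`, computed with respect to the cut point `c`. -/
def dA (aE : EReal) (f : ℝ → ℝ) (c : ℝ) : ℝ≥0∞ :=
  limsup (fun D => IaStar aE f c D) (𝓝[>] (mA aE f).toReal) - IaInt aE f c (mA aE f).toReal

/-- Condition (B) at `b`. -/
def CondB_b (aE bE : EReal) (f : ℝ → ℝ) (J : Set ℝ) : Prop :=
  CondA_b aE bE f ∨ ∃ c, RelMinB aE bE f c ∧ EMetric.diam J ≤ 2 * dB bE f c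

/-- Condition (B) at `a`. -/
def CondB_a (aE bE : EReal) (f : ℝ → ℝ) (J : Set ℝ) : Prop :=
  CondA_a aE bE f ∨ ∃ c, RelMinA aE bE f c ∧ EMetric.diam J ≤ 2 * dA aE f c

/-- Condition (B). -/
def CondB (aE bE : EReal) (f : ℝ → ℝ) (J : Set ℝ) : Prop :=
  CondB_a aE bE f J ∧ CondB_b aE bE f J

/-- `m = inf_{(a,b)} G`. -/
def mGlob (aE bE : EReal) (f : ℝ → ℝ) : ℝ := sInf (G f '' II aE bE)

/-- `α(D) = sup {τ ∈ (a,b) | G τ = D}`. -/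
def alphaD (aE bE : EReal) (f : ℝ → ℝ) (D : ℝ) : EReal :=
  sSup ((fun τ : ℝ => (τ : EReal)) '' {τ : ℝ | τ ∈ II aE bE ∧ G f τ = D})

/-- `β(D) = inf {τ ∈ (a,b) | G τ = D}`. -/
def betaD (aE bE : EReal) (f : ℝ → ℝ) (D : ℝ) : EReal :=
  sInf ((fun τ : ℝ => (τ : EReal)) '' {τ : ℝ | τ ∈ II aE bE ∧ G f τ = D})

/-- `i_b = inf_{D ∈ (m, m_b)} ∫_{α(D)}^b f⁻²(G−D)^{-1/2}`. -/
def iB (aE bE : EReal) (f : ℝ → ℝ) : ℝ≥0∞ :=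
  ⨅ D ∈ Ioo (mGlob aE bE f) (mB bE f).toReal,
    ∫⁻ τ in {τ : ℝ | alphaD aE bE f D < (τ : EReal) ∧ (τ : EReal) < bE}, h f D τ

/-- `i_a = inf_{D ∈ (m, m_a)} ∫_a^{β(D)} f⁻²(G−D)^{-1/2}`. -/
def iA (aE bE : EReal) (f : ℝ → ℝ) : ℝ≥0∞ :=
  ⨅ D ∈ Ioo (mGlob aE bE f) (mA aE f).toReal,
    ∫⁻ τ in {τ : ℝ | aE < (τ : EReal) ∧ (τ : EReal) < betaD aE bE f D}, h f D τ

/-- Condition (C) at `b`. -/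
def CondC_b (aE bE : EReal) (f : ℝ → ℝ) (J : Set ℝ) : Prop :=
  CondB_b aE bE f J ∨
    ((mGlob aE bE f : EReal) < mB bE f ∧ ∃ c, RelMinB aE bE f c ∧ iB aE bE f ≤ dB bE f c)

/-- Condition (C) at `a`. -/
def CondC_a (aE bE : EReal) (f : ℝ → ℝ) (J : Set ℝ) : Prop :=
  CondB_a aE bE f J ∨
    ((mGlob aE bE f : EReal) < mA aE f ∧ ∃ c, RelMinA aE bE f c ∧ iA aE bE f ≤ dA aE f c)

/-- Condition (C). -/
def CondC (aE bE : EReal) (f : ℝ → ℝ) (J : Set ℝ) : Prop :=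
  CondC_a aE bE f J ∧ CondC_b aE bE f J

/-! ### Condition (R) -/

/-- `b^*(D) = inf {τ ∈ [τ0, b) | G τ = D}` (defaulting to `b`). -/
def bstarR (bE : EReal) (f : ℝ → ℝ) (τ0 D : ℝ) : EReal :=
  sInf (insert bE ((fun τ : ℝ => (τ : EReal)) ''
    {τ : ℝ | τ0 ≤ τ ∧ (τ : EReal) < bE ∧ G f τ = D}))

/-- `a^*(D) = sup {τ ∈ (a, τ0] | G τ = D}` (defaulting to `a`). -/
def astarR (aE : EReal) (f : ℝ → ℝ) (τ0 D : ℝ) : EReal :=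
  sSup (insert aE ((fun τ : ℝ => (τ : EReal)) ''
    {τ : ℝ | τ ≤ τ0 ∧ aE < (τ : EReal) ∧ G f τ = D}))

/-- `A(D) = ∫_{a^*(D)}^{τ0} h_D`. -/
def AInt (aE : EReal) (f : ℝ → ℝ) (τ0 D : ℝ) : ℝ≥0∞ :=
  ∫⁻ τ in {τ : ℝ | astarR aE f τ0 D < (τ : EReal) ∧ τ < τ0}, h f D τ

/-- `B(D) = ∫_{τ0}^{b^*(D)} h_D`. -/
def BInt (bE : EReal) (f : ℝ → ℝ) (τ0 D : ℝ) : ℝ≥0∞ :=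
  ∫⁻ τ in {τ : ℝ | τ0 < τ ∧ (τ : EReal) < bstarR bE f τ0 D}, h f D τ

/-- `T(D) = ∫_{a^*(D)}^{b^*(D)} h_D`. -/
def TInt (aE bE : EReal) (f : ℝ → ℝ) (τ0 D : ℝ) : ℝ≥0∞ :=
  ∫⁻ τ in {τ : ℝ | astarR aE f τ0 D < (τ : EReal) ∧ (τ : EReal) < bstarR bE f τ0 D},
    h f D τ

/-- The point `b − ε` (replaced by `1/ε` when `b = ∞`). -/
def bEnd (bE : EReal) (ε : ℝ) : ℝ := if bE = ⊤ then ε⁻¹ else bE.toReal - ε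

/-- The point `a + ε` (replaced by `−1/ε` when `a = −∞`). -/
def aEnd (aE : EReal) (ε : ℝ) : ℝ := if aE = ⊥ then -ε⁻¹ else aE.toReal + ε

/-- The oriented integral `Q(D,ε) = ∫_{b−ε}^{b^*(D)} h_D`, valued in `[−∞,∞]`. -/
def QInt (bE : EReal) (f : ℝ → ℝ) (τ0 D ε : ℝ) : EReal :=
  if ((bEnd bE ε : ℝ) : EReal) ≤ bstarR bE f τ0 D then
    ((∫⁻ τ in {τ : ℝ | bEnd bE ε < τ ∧ (τ : EReal) < bstarR bE f τ0 D}, h f D τ : ℝ≥0∞) :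
      EReal)
  else
    -((∫⁻ τ in {τ : ℝ | bstarR bE f τ0 D < (τ : EReal) ∧ τ < bEnd bE ε}, h f D τ : ℝ≥0∞) :
      EReal)

/-- The oriented integral `Q'(D,ε) = ∫_{a^*(D)}^{a+ε} h_D`, valued in `[−∞,∞]`. -/
def QInt' (aE : EReal) (f : ℝ → ℝ) (τ0 D ε : ℝ) : EReal :=
  if astarR aE f τ0 D ≤ ((aEnd aE ε : ℝ) : EReal) then
    ((∫⁻ τ in {τ : ℝ | astarR aE f τ0 D < (τ : EReal) ∧ τ < aEnd aE ε}, h f D τ : ℝ≥0∞) :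
      EReal)
  else
    -((∫⁻ τ in {τ : ℝ | aEnd aE ε < τ ∧ (τ : EReal) < astarR aE f τ0 D}, h f D τ : ℝ≥0∞) :
      EReal)

/-- `C_n(D)`: `B(D)` for even `n`, `A(D)` for odd `n`. -/
def CInt (aE bE : EReal) (f : ℝ → ℝ) (τ0 : ℝ) (n : ℕ) (D : ℝ) : ℝ≥0∞ :=
  if Even n then BInt bE f τ0 D else AInt aE f τ0 D

/-- `C'_n(D)`: `A(D)` for even `n`, `B(D)` for odd `n`. -/
def CInt' (aE bE : EReal) (f : ℝ → ℝ) (τ0 : ℝ) (n : ℕ) (D : ℝ) : ℝ≥0∞ :=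
  if Even n then AInt aE f τ0 D else BInt bE f τ0 D

/-- `r_i^n(τ0) = lim_{ε↘0} liminf_{D↘m} (C_n(D) + n·T(D) − Q(D,ε))`; since the inner
quantity is nonincreasing in `ε`, the limit as `ε ↘ 0` is the supremum over `ε > 0`. -/
def rI (aE bE : EReal) (f : ℝ → ℝ) (τ0 : ℝ) (n : ℕ) : EReal :=
  ⨆ ε : {e : ℝ // 0 < e},
    liminf (fun D =>
        ((CInt aE bE f τ0 n D + n * TInt aE bE f τ0 D : ℝ≥0∞) : EReal)
          - QInt bE f τ0 D ε.1)
      (𝓝[>] (mGlob aE bE f))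

/-- `r_s^n(τ0) = lim_{ε↘0} limsup_{D↘m} (C_n(D) + n·T(D) + Q(D,ε))`. -/
def rS (aE bE : EReal) (f : ℝ → ℝ) (τ0 : ℝ) (n : ℕ) : EReal :=
  ⨅ ε : {e : ℝ // 0 < e},
    limsup (fun D =>
        ((CInt aE bE f τ0 n D + n * TInt aE bE f τ0 D : ℝ≥0∞) : EReal)
          + QInt bE f τ0 D ε.1)
      (𝓝[>] (mGlob aE bE f))

/-- `l_i^n(τ0) = lim_{ε↘0} liminf_{D↘m} (C'_n(D) + n·T(D) − Q'(D,ε))`. -/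
def lI (aE bE : EReal) (f : ℝ → ℝ) (τ0 : ℝ) (n : ℕ) : EReal :=
  ⨆ ε : {e : ℝ // 0 < e},
    liminf (fun D =>
        ((CInt' aE bE f τ0 n D + n * TInt aE bE f τ0 D : ℝ≥0∞) : EReal)
          - QInt' aE f τ0 D ε.1)
      (𝓝[>] (mGlob aE bE f))

/-- `l_s^n(τ0) = lim_{ε↘0} limsup_{D↘m} (C'_n(D) + n·T(D) + Q'(D,ε))`. -/
def lS (aE bE : EReal) (f : ℝ → ℝ) (τ0 : ℝ) (n : ℕ) : EReal :=
  ⨅ ε : {e : ℝ // 0 < e},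
    limsup (fun D =>
        ((CInt' aE bE f τ0 n D + n * TInt aE bE f τ0 D : ℝ≥0∞) : EReal)
          + QInt' aE f τ0 D ε.1)
      (𝓝[>] (mGlob aE bE f))

/-- Condition (R). -/
def CondR (aE bE : EReal) (f : ℝ → ℝ) (J : Set ℝ) : Prop :=
  (∀ τ ∈ II aE bE, mGlob aE bE f < G f τ) ∧
  mA aE f = (mGlob aE bE f : EReal) ∧ mB bE f = (mGlob aE bE f : EReal) ∧
  ∀ τ0 ∈ II aE bE,
    (Icc (rI aE bE f τ0 0) ((EMetric.diam J : ℝ≥0∞) : EReal) ⊆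
        ⋃ n : ℕ, Icc (rI aE bE f τ0 n) (rS aE bE f τ0 n)) ∧
    (Icc (lI aE bE f τ0 0) ((EMetric.diam J : ℝ≥0∞) : EReal) ⊆
        ⋃ n : ℕ, Icc (lI aE bE f τ0 n) (lS aE bE f τ0 n))

end GRW

open Set Filter MeasureTheory Topology GRW
open scoped ENNReal

namespace GRWaux

lemma isOpen_II (aE bE : EReal) : IsOpen (II aE bE) := by
  have : II aE bE = (fun τ : ℝ => (τ : EReal)) ⁻¹' (Ioo aE bE) := rfl
  rw [this]
  exact isOpen_Ioo.preimage continuous_coe_real_ereal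

lemma ordConn_II (aE bE : EReal) : OrdConnected (II aE bE) := by
  constructor
  intro x hx y hy z hz
  exact ⟨lt_of_lt_of_le hx.1 (by exact_mod_cast hz.1), lt_of_le_of_lt (by exact_mod_cast hz.2) hy.2⟩

lemma ftc {U : Set ℝ} (hU : IsOpen U) (hc : OrdConnected U) {g : ℝ → ℝ} (hg : ContinuousOn g U)
    {a τ : ℝ} (ha : a ∈ U) (hτ : τ ∈ U) :
    HasDerivAt (fun u => ∫ v in a..u, g v) (g τ) τ := by
  apply intervalIntegral.integral_hasDerivAt_right
  · exact (hg.mono (hc.uIcc_subset ha hτ)).intervalIntegrable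
  · exact hg.stronglyMeasurableAtFilter hU τ hτ
  · exact hg.continuousAt (hU.mem_nhds hτ)

lemma const_of {φ : ℝ → ℝ} {t1 : ℝ} (hd : ∀ t ∈ Icc 0 t1, HasDerivWithinAt φ 0 (Icc 0 t1) t) :
    ∀ t ∈ Icc 0 t1, φ t = φ 0 := by
  apply constant_of_derivWithin_zero
  · exact fun t ht => (hd t ht).differentiableWithinAt
  · intro t ht
    have ht' := Ico_subset_Icc_self ht
    exact (hd t ht').derivWithin (uniqueDiffOn_Icc (ht.1.trans_lt ht.2) t ht')

lemma sign_of {p : ℝ → ℝ} (hp : ContinuousOn p (Icc 0 1)) (hn : ∀ t ∈ Icc (0:ℝ) 1, p t ≠ 0) :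
    (∀ t ∈ Icc (0:ℝ) 1, 0 < p t) ∨ (∀ t ∈ Icc (0:ℝ) 1, p t < 0) := by
  by_contra hcon
  push Not at hcon
  obtain ⟨⟨a, ha, ha'⟩, b, hb, hb'⟩ := hcon
  obtain ⟨c, hc, hc'⟩ := isPreconnected_Icc.intermediate_value ha hb hp ⟨ha', hb'⟩
  exact hn c hc hc'

lemma strictMono_of {φ φ' : ℝ → ℝ} {a b : ℝ}
    (hd : ∀ t ∈ Icc a b, HasDerivWithinAt φ (φ' t) (Icc a b) t)
    (hp : ∀ t ∈ Icc a b, 0 < φ' t) : StrictMonoOn φ (Icc a b) :=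
  strictMonoOn_of_hasDerivWithinAt_pos (convex_Icc a b) (fun t ht => (hd t ht).continuousWithinAt)
    (fun t ht => (hd t (interior_subset ht)).mono interior_subset)
    (fun t ht => hp t (interior_subset ht))

lemma mono_of {φ φ' : ℝ → ℝ} {a b : ℝ}
    (hd : ∀ t ∈ Icc a b, HasDerivWithinAt φ (φ' t) (Icc a b) t)
    (hp : ∀ t ∈ Icc a b, 0 ≤ φ' t) : MonotoneOn φ (Icc a b) :=
  monotoneOn_of_hasDerivWithinAt_nonneg (convex_Icc a b)
    (fun t ht => (hd t ht).continuousWithinAt)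
    (fun t ht => (hd t (interior_subset ht)).mono interior_subset)
    (fun t ht => hp t (interior_subset ht))

lemma inv_exists {w : ℝ → ℝ} {a b : ℝ} (hab : a < b) (hw : ContinuousOn w (Icc a b))
    (hpos : ∀ u ∈ Icc a b, 0 < w u) (hint : ∫ u in a..b, (w u)⁻¹ = 1) :
    ∃ σ : ℝ → ℝ, σ 0 = a ∧ σ 1 = b ∧ ∀ t ∈ Icc (0:ℝ) 1, σ t ∈ Icc a b ∧
      HasDerivWithinAt σ (w (σ t)) (Icc 0 1) t := by
  set g : ℝ → ℝ := fun u => (w (projIcc a b hab.le u))⁻¹ with hg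
  have hgpos : ∀ u, 0 < g u := fun u => inv_pos.2 (hpos _ (projIcc a b hab.le u).2)
  have hwp : Continuous (fun u => w (projIcc a b hab.le u)) :=
    hw.domRestrict.comp continuous_projIcc
  have hgc : Continuous g := hwp.inv₀ (fun u => (hpos _ (projIcc a b hab.le u).2).ne')
  have hgeq : ∀ u ∈ Icc a b, g u = (w u)⁻¹ := by
    intro u hu
    simp only [hg, projIcc_of_mem hab.le hu]
  obtain ⟨M, hM⟩ := isCompact_Icc.bddAbove_image hw
  have hMb : ∀ u ∈ Icc a b, w u ≤ M := fun u hu => hM (mem_image_of_mem w hu)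
  have hMpos : 0 < M := (hpos a (left_mem_Icc.2 hab.le)).trans_le (hMb a (left_mem_Icc.2 hab.le))
  have hgM : ∀ u, M⁻¹ ≤ g u := fun u =>
    inv_anti₀ (hpos _ (projIcc a b hab.le u).2) (hMb _ (projIcc a b hab.le u).2)
  set T : ℝ → ℝ := fun u => ∫ v in a..u, g v with hT
  have hTd : ∀ u, HasDerivAt T (g u) u := fun u =>
    ftc isOpen_univ ordConnected_univ hgc.continuousOn (mem_univ a) (mem_univ u)
  have hTa : T a = 0 := by simp [hT]
  have hTb : T b = 1 := by
    rw [← hint]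
    apply intervalIntegral.integral_congr
    intro u hu
    rw [uIcc_of_le hab.le] at hu
    exact hgeq u hu
  have hTmono : StrictMono T := strictMono_of_deriv_pos (fun u => by
    rw [(hTd u).deriv]; exact hgpos u)
  have hTc : Continuous T := continuous_iff_continuousAt.2 fun u => (hTd u).continuousAt
  have hdiff : Monotone (fun u => T u - M⁻¹ * u) := by
    have hd : ∀ u, HasDerivAt (fun u => T u - M⁻¹ * u) (g u - M⁻¹ * 1) u := fun u =>
      (hTd u).sub ((hasDerivAt_id u).const_mul _)
    apply monotone_of_deriv_nonneg (fun u => (hd u).differentiableAt)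
    intro u
    rw [(hd u).deriv]
    have := hgM u
    linarith
  have hMi : 0 < M⁻¹ := inv_pos.2 hMpos
  have htop : Tendsto T atTop atTop := by
    have h1 : Tendsto (fun u : ℝ => M⁻¹ * u + (-(M⁻¹ * a))) atTop atTop :=
      tendsto_atTop_add_const_right _ _ (tendsto_id.const_mul_atTop hMi)
    apply tendsto_atTop_mono' _ _ h1
    filter_upwards [eventually_ge_atTop a] with u hu
    have := hdiff hu
    simp only [hTa] at this
    linarith
  have hbot : Tendsto T atBot atBot := by
    have h1 : Tendsto (fun u : ℝ => M⁻¹ * u + (-(M⁻¹ * a))) atBot atBot :=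
      tendsto_atBot_add_const_right _ _ (tendsto_id.const_mul_atBot hMi)
    apply tendsto_atBot_mono' _ _ h1
    filter_upwards [eventually_le_atBot a] with u hu
    have := hdiff hu
    simp only [hTa] at this
    linarith
  have hsurj : Function.Surjective T := hTc.surjective htop hbot
  let e : ℝ ≃o ℝ := hTmono.orderIsoOfSurjective T hsurj
  have heT : ∀ u, e u = T u := fun u => rfl
  have h0 : e.symm 0 = a := by rw [OrderIso.symm_apply_eq, heT, hTa]
  have h1 : e.symm 1 = b := by rw [OrderIso.symm_apply_eq, heT, hTb]
  refine ⟨e.symm, h0, h1, ?_⟩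
  intro t ht
  have hmem : e.symm t ∈ Icc a b :=
    ⟨by rw [← h0]; exact e.symm.monotone ht.1, by rw [← h1]; exact e.symm.monotone ht.2⟩
  refine ⟨hmem, ?_⟩
  have := HasDerivAt.of_local_left_inverse (f := T) (g := e.symm) (a := t)
    e.symm.continuous.continuousAt (hTd _) (hgpos _).ne'
    (Eventually.of_forall fun y => by rw [← heT]; simp)
  rw [hgeq _ hmem, inv_inv] at this
  exact this.hasDerivWithinAt

/-- The radicand. -/
def NN (f : ℝ → ℝ) (s τ : ℝ) : ℝ := 1 - s ^ 2 + s ^ 2 * ((f τ) ^ 2)⁻¹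

/-- The normalised speed. -/
def WW (f : ℝ → ℝ) (s τ : ℝ) : ℝ := Real.sqrt (NN f s τ)

/-- The integrand of the fiber displacement. -/
def QQ (f : ℝ → ℝ) (s τ : ℝ) : ℝ := s / ((f τ) ^ 2 * WW f s τ)

lemma NN_pos {f : ℝ → ℝ} {s τ : ℝ} (hs : s ∈ Icc (-1:ℝ) 1) (hf : 0 < f τ) : 0 < NN f s τ := by
  have h1 : s ^ 2 ≤ 1 := by nlinarith [hs.1, hs.2]
  have h2 : 0 < ((f τ) ^ 2)⁻¹ := by positivity
  unfold NN
  rcases eq_or_ne s 0 with rfl | h0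
  · norm_num
  · have : 0 < s ^ 2 := by positivity
    have := mul_pos this h2
    linarith

lemma WW_pos {f : ℝ → ℝ} {s τ : ℝ} (hs : s ∈ Icc (-1:ℝ) 1) (hf : 0 < f τ) : 0 < WW f s τ :=
  Real.sqrt_pos.2 (NN_pos hs hf)

lemma WW_sq {f : ℝ → ℝ} {s τ : ℝ} (hs : s ∈ Icc (-1:ℝ) 1) (hf : 0 < f τ) :
    WW f s τ ^ 2 = NN f s τ := Real.sq_sqrt (NN_pos hs hf).le

lemma NN_contDiff {f : ℝ → ℝ} {U : Set ℝ} (hf : ContDiffOn ℝ (⊤ : ℕ∞) f U)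
    (hpos : ∀ τ ∈ U, 0 < f τ) (s : ℝ) : ContDiffOn ℝ (⊤ : ℕ∞) (NN f s) U :=
  contDiffOn_const.add (contDiffOn_const.mul ((hf.pow 2).inv
    (fun τ hτ => (pow_pos (hpos τ hτ) 2).ne')))

lemma WW_contDiff {f : ℝ → ℝ} {U : Set ℝ} (hf : ContDiffOn ℝ (⊤ : ℕ∞) f U)
    (hpos : ∀ τ ∈ U, 0 < f τ) {s : ℝ} (hs : s ∈ Icc (-1:ℝ) 1) :
    ContDiffOn ℝ (⊤ : ℕ∞) (WW f s) U :=
  (NN_contDiff hf hpos s).sqrt (fun τ hτ => (NN_pos hs (hpos τ hτ)).ne')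

lemma QQ_cont {f : ℝ → ℝ} {U : Set ℝ} (hf : ContDiffOn ℝ (⊤ : ℕ∞) f U)
    (hpos : ∀ τ ∈ U, 0 < f τ) {s : ℝ} (hs : s ∈ Icc (-1:ℝ) 1) : ContinuousOn (QQ f s) U :=
  continuousOn_const.div ((hf.continuousOn.pow 2).mul (WW_contDiff hf hpos hs).continuousOn)
    (fun τ hτ => (mul_pos (pow_pos (hpos τ hτ) 2) (WW_pos hs (hpos τ hτ))).ne')

lemma WWinv_cont {f : ℝ → ℝ} {U : Set ℝ} (hf : ContDiffOn ℝ (⊤ : ℕ∞) f U)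
    (hpos : ∀ τ ∈ U, 0 < f τ) {s : ℝ} (hs : s ∈ Icc (-1:ℝ) 1) :
    ContinuousOn (fun τ => (WW f s τ)⁻¹) U :=
  (WW_contDiff hf hpos hs).continuousOn.inv₀ (fun τ hτ => (WW_pos hs (hpos τ hτ)).ne')

lemma WW_one {f : ℝ → ℝ} {s τ : ℝ} (hs : s ^ 2 = 1) (hf : 0 < f τ) : WW f s τ = (f τ)⁻¹ := by
  unfold WW NN
  rw [hs, ← inv_pow]
  simp [hf.le]

lemma QQ_one {f : ℝ → ℝ} {s τ : ℝ} (hs : s ^ 2 = 1) (hf : 0 < f τ) :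
    QQ f s τ = s * (f τ)⁻¹ := by
  unfold QQ
  rw [WW_one hs hf]
  field_simp

lemma NN_cont_s (f : ℝ → ℝ) (τ : ℝ) : Continuous (fun s => NN f s τ) := by
  unfold NN; fun_prop

lemma QQ_cont_s {f : ℝ → ℝ} {τ : ℝ} (hf : 0 < f τ) :
    ContinuousOn (fun s => QQ f s τ) (Icc (-1) 1) := by
  unfold QQ
  apply continuousOn_id.div
  · exact continuousOn_const.mul (Real.continuous_sqrt.comp (NN_cont_s f τ)).continuousOn
  · intro s hs
    exact (mul_pos (pow_pos hf 2) (WW_pos hs hf)).ne'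

lemma QQ_strictMono {f : ℝ → ℝ} {τ : ℝ} (hf : 0 < f τ) :
    StrictMonoOn (fun s => QQ f s τ) (Icc (-1) 1) := by
  set g := ((f τ) ^ 2)⁻¹ with hg
  apply strictMonoOn_of_hasDerivWithinAt_pos (convex_Icc _ _) (QQ_cont_s hf)
    (f' := fun s => g / (WW f s τ) ^ 3)
  · intro s hs
    have hs' := interior_subset hs
    have hN := NN_pos hs' hf
    have hW := WW_pos hs' hf
    have hW2 := WW_sq hs' hf
    have hNd : HasDerivAt (fun s => NN f s τ) (-(2 * s) + (2 * s) * g) s := by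
      have h1 : HasDerivAt (fun s : ℝ => s ^ 2) (2 * s) s := by simpa using hasDerivAt_pow 2 s
      have := (h1.const_sub 1).add (h1.mul_const g)
      exact this
    have hWd : HasDerivAt (fun s => WW f s τ) ((-(2 * s) + (2 * s) * g) / (2 * WW f s τ)) s :=
      hNd.sqrt hN.ne'
    have hne : (f τ) ^ 2 * WW f s τ ≠ 0 := (mul_pos (pow_pos hf 2) hW).ne'
    have := (hasDerivAt_id s).div (hWd.const_mul ((f τ) ^ 2)) hne
    refine HasDerivAt.hasDerivWithinAt ?_
    convert! this using 1
    have hNv : WW f s τ ^ 2 = 1 - s ^ 2 + s ^ 2 * g := hW2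
    have hfg : (f τ) ^ 2 * g = 1 := mul_inv_cancel₀ (pow_pos hf 2).ne'
    have hf2 := (pow_pos hf 2).ne'
    simp only [id]
    have hnum : 1 * ((f τ) ^ 2 * WW f s τ)
        - s * ((f τ) ^ 2 * ((-(2 * s) + (2 * s) * g) / (2 * WW f s τ)))
        = (f τ) ^ 2 / WW f s τ := by
      clear_value g
      field_simp
      linear_combination hNv
    rw [hnum, hg]
    field_simp
  · intro s hs
    have hW := WW_pos (interior_subset hs) hf
    positivity

lemma abs_QQ_le {f : ℝ → ℝ} {s τ : ℝ} (hs : s ∈ Icc (-1:ℝ) 1) (hf : 0 < f τ) :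
    |QQ f s τ| ≤ (f τ)⁻¹ := by
  have h1 := (QQ_strictMono hf).monotoneOn hs (right_mem_Icc.2 (by norm_num)) hs.2
  have h2 := (QQ_strictMono hf).monotoneOn (left_mem_Icc.2 (by norm_num)) hs hs.1
  rw [QQ_one (s := 1) (by norm_num) hf] at h1
  rw [QQ_one (s := -1) (by norm_num) hf] at h2
  rw [abs_le]
  constructor <;> linarith

lemma Phi_strictMono {f : ℝ → ℝ} {U : Set ℝ} (hf : ContDiffOn ℝ (⊤ : ℕ∞) f U)
    (hpos : ∀ τ ∈ U, 0 < f τ) {a b : ℝ} (hab : a < b) (hsub : Icc a b ⊆ U) :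
    StrictMonoOn (fun s => ∫ τ in a..b, QQ f s τ) (Icc (-1) 1) := by
  intro s hs r hr hsr
  apply intervalIntegral.integral_lt_integral_of_continuousOn_of_le_of_exists_lt hab
    ((QQ_cont hf hpos hs).mono hsub) ((QQ_cont hf hpos hr).mono hsub)
  · intro τ hτ
    exact (QQ_strictMono (hpos τ (hsub (Ioc_subset_Icc_self hτ))) hs hr hsr).le
  · exact ⟨a, left_mem_Icc.2 hab.le,
      QQ_strictMono (hpos a (hsub (left_mem_Icc.2 hab.le))) hs hr hsr⟩

lemma Phi_cont {f : ℝ → ℝ} {U : Set ℝ} (hf : ContDiffOn ℝ (⊤ : ℕ∞) f U)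
    (hpos : ∀ τ ∈ U, 0 < f τ) {a b : ℝ} (hab : a < b) (hsub : Icc a b ⊆ U) :
    ContinuousOn (fun s => ∫ τ in a..b, QQ f s τ) (Icc (-1) 1) := by
  intro s hs
  have hI : Set.uIoc a b ⊆ U := by
    rw [uIoc_of_le hab.le]; exact Ioc_subset_Icc_self.trans hsub
  apply intervalIntegral.continuousWithinAt_of_dominated_interval (bound := fun τ => (f τ)⁻¹)
  · filter_upwards [self_mem_nhdsWithin] with r hr
    exact ((QQ_cont hf hpos hr).mono hI).aestronglyMeasurable measurableSet_uIoc
  · filter_upwards [self_mem_nhdsWithin] with r hr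
    refine Eventually.of_forall fun τ hτ => ?_
    exact abs_QQ_le hr (hpos τ (hI hτ))
  · apply ContinuousOn.intervalIntegrable
    rw [uIcc_of_le hab.le]
    exact (hf.continuousOn.mono hsub).inv₀ (fun τ hτ => (hpos τ (hsub hτ)).ne')
  · refine Eventually.of_forall fun τ hτ => ?_
    exact QQ_cont_s (hpos τ (hI hτ)) s hs

lemma Phi_one {f : ℝ → ℝ} {U : Set ℝ}
    (hpos : ∀ τ ∈ U, 0 < f τ) {a b : ℝ} (hab : a < b) (hsub : Icc a b ⊆ U) {s : ℝ}
    (hs : s ^ 2 = 1) : ∫ τ in a..b, QQ f s τ = s * ∫ τ in a..b, (f τ)⁻¹ := by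
  rw [← intervalIntegral.integral_const_mul]
  apply intervalIntegral.integral_congr
  intro τ hτ
  rw [uIcc_of_le hab.le] at hτ
  exact QQ_one hs (hpos τ (hsub hτ))

lemma conserv {aE bE : EReal} {f : ℝ → ℝ} {J : Set ℝ}
    (hf : ContDiffOn ℝ (⊤ : ℕ∞) f (II aE bE)) (hpos : ∀ τ ∈ II aE bE, 0 < f τ)
    {σ x : ℝ → ℝ} {t1 : ℝ} (ht1 : 0 < t1) (hg : IsGeodesicOn aE bE f J σ x 0 t1) :
    ∃ (k D : ℝ) (p : ℝ → ℝ), ContinuousOn p (Icc 0 t1) ∧ ∀ t ∈ Icc 0 t1,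
      HasDerivWithinAt x (k / (f (σ t)) ^ 2) (Icc 0 t1) t ∧
      HasDerivWithinAt σ (p t) (Icc 0 t1) t ∧
      p t ^ 2 = k ^ 2 * ((f (σ t)) ^ 2)⁻¹ - D ∧ energyW f σ x 0 t1 t = D := by
  set I := Icc 0 t1 with hI
  have hud : UniqueDiffOn ℝ I := uniqueDiffOn_Icc ht1
  set p := derivWithin σ I with hp
  set q := derivWithin x I with hq
  have h2 : (2 : WithTop ℕ∞) = 1 + 1 := by norm_num
  have hpC : ContDiffOn ℝ 1 p I := by
    have := hg.smooth_base
    rw [h2, contDiffOn_succ_iff_derivWithin hud] at this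
    exact this.2.2
  have hqC : ContDiffOn ℝ 1 q I := by
    have := hg.smooth_fiber
    rw [h2, contDiffOn_succ_iff_derivWithin hud] at this
    exact this.2.2
  have hσd : ∀ t ∈ I, HasDerivWithinAt σ (p t) I t := fun t ht =>
    (hg.smooth_base.differentiableOn (by norm_num) t ht).hasDerivWithinAt
  have hxd : ∀ t ∈ I, HasDerivWithinAt x (q t) I t := fun t ht =>
    (hg.smooth_fiber.differentiableOn (by norm_num) t ht).hasDerivWithinAt
  have hpd : ∀ t ∈ I, HasDerivWithinAt p (-(f (σ t) * deriv f (σ t) * q t ^ 2)) I t := by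
    intro t ht
    rw [← hg.eq_base t ht]
    exact (hpC.differentiableOn (by norm_num) t ht).hasDerivWithinAt
  have hqd : ∀ t ∈ I, HasDerivWithinAt q
      (-(2 * (deriv f (σ t) / f (σ t)) * p t * q t)) I t := by
    intro t ht
    rw [← hg.eq_fiber t ht]
    exact (hqC.differentiableOn (by norm_num) t ht).hasDerivWithinAt
  have hfd : ∀ t ∈ I, HasDerivWithinAt (fun t => f (σ t)) (deriv f (σ t) * p t) I t := by
    intro t ht
    have hm := hg.mem_base t ht
    have : HasDerivAt f (deriv f (σ t)) (σ t) :=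
      ((hf.contDiffAt ((isOpen_II aE bE).mem_nhds hm)).differentiableAt (by norm_num)).hasDerivAt
    exact this.comp_hasDerivWithinAt t (hσd t ht)
  have hfp : ∀ t ∈ I, 0 < f (σ t) := fun t ht => hpos _ (hg.mem_base t ht)
  have hK : ∀ t ∈ I, (f (σ t)) ^ 2 * q t = (f (σ 0)) ^ 2 * q 0 := by
    apply const_of (φ := fun t => (f (σ t)) ^ 2 * q t)
    intro t ht
    have := ((hfd t ht).pow 2).mul (hqd t ht)
    convert! this using 1
    have := (hfp t ht).ne'
    simp only [Pi.pow_apply, Nat.add_one_sub_one, Nat.cast_ofNat, pow_one]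
    field_simp
    ring
  have hE : ∀ t ∈ I, -(p t) ^ 2 + (f (σ t)) ^ 2 * (q t) ^ 2
      = -(p 0) ^ 2 + (f (σ 0)) ^ 2 * (q 0) ^ 2 := by
    apply const_of (φ := fun t => -(p t) ^ 2 + (f (σ t)) ^ 2 * (q t) ^ 2)
    intro t ht
    have := ((hpd t ht).pow 2).neg.add (((hfd t ht).pow 2).mul ((hqd t ht).pow 2))
    convert! this using 1
    have := (hfp t ht).ne'
    simp only [Pi.pow_apply, Nat.add_one_sub_one, Nat.cast_ofNat, pow_one]
    field_simp
    ring
  refine ⟨(f (σ 0)) ^ 2 * q 0, -(p 0) ^ 2 + (f (σ 0)) ^ 2 * (q 0) ^ 2, p, hpC.continuousOn, ?_⟩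
  intro t ht
  have hne := (hfp t ht).ne'
  have hqk : q t = (f (σ 0)) ^ 2 * q 0 / (f (σ t)) ^ 2 := by
    rw [← hK t ht]; field_simp
  refine ⟨?_, hσd t ht, ?_, hE t ht⟩
  · rw [← hqk]; exact hxd t ht
  · rw [← hE t ht, ← hK t ht]
    field_simp
    ring

lemma no_spacelike {aE bE : EReal} {f : ℝ → ℝ} {J : Set ℝ}
    (hf : ContDiffOn ℝ (⊤ : ℕ∞) f (II aE bE)) (hpos : ∀ τ ∈ II aE bE, 0 < f τ)
    {σ x : ℝ → ℝ} {t1 : ℝ} (ht1 : 0 < t1) (hg : IsGeodesicOn aE bE f J σ x 0 t1)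
    (hcaus : |x t1 - x 0| ≤ ∫ τ in (σ 0)..(σ t1), (f τ)⁻¹)
    {t : ℝ} (ht : t ∈ Icc 0 t1) (hE : 0 < energyW f σ x 0 t1 t) : False := by
  obtain ⟨k, D, p, hpc, H⟩ := conserv hf hpos ht1 hg
  have hD : 0 < D := by rw [← (H t ht).2.2.2]; exact hE
  have h0 : (0:ℝ) ∈ Icc 0 t1 := left_mem_Icc.2 ht1.le
  have h1 : t1 ∈ Icc 0 t1 := right_mem_Icc.2 ht1.le
  have hfi : ContinuousOn (fun τ => (f τ)⁻¹) (II aE bE) :=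
    hf.continuousOn.inv₀ (fun τ hτ => (hpos τ hτ).ne')
  have key : ∀ e : ℝ, e * k = |k| →
      StrictMonoOn (fun t => e * x t - ∫ τ in (σ 0)..(σ t), (f τ)⁻¹) (Icc 0 t1) := by
    intro e he
    apply strictMono_of (φ' := fun t => e * (k / (f (σ t)) ^ 2) - (f (σ t))⁻¹ * p t)
    · intro t ht
      obtain ⟨hx, hs, -, -⟩ := H t ht
      exact (hx.const_mul e).sub ((ftc (isOpen_II aE bE) (ordConn_II aE bE) hfi
        (hg.mem_base 0 h0) (hg.mem_base t ht)).comp_hasDerivWithinAt t hs)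
    · intro t ht
      obtain ⟨-, -, hs, -⟩ := H t ht
      have hfp := hpos _ (hg.mem_base t ht)
      have h3 : p t < |k| * (f (σ t))⁻¹ := by
        apply lt_of_pow_lt_pow_left₀ 2 (by positivity)
        rw [mul_pow, sq_abs, hs, inv_pow]
        linarith
      have h4 : e * (k / (f (σ t)) ^ 2) - (f (σ t))⁻¹ * p t
          = (f (σ t))⁻¹ * (|k| * (f (σ t))⁻¹ - p t) := by
        rw [← he]; field_simp
      rw [h4]
      exact mul_pos (inv_pos.2 hfp) (by linarith)
  have fin : ∀ e : ℝ, |e| = 1 → e * k = |k| → False := by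
    intro e he hek
    have := key e hek h0 h1 ht1
    simp only [intervalIntegral.integral_same] at this
    have h5 : e * (x t1 - x 0) ≤ |x t1 - x 0| := by
      calc _ ≤ |e * (x t1 - x 0)| := le_abs_self _
        _ = _ := by rw [abs_mul, he, one_mul]
    linarith
  rcases le_total 0 k with hk | hk
  · exact fin 1 (by simp) (by rw [abs_of_nonneg hk, one_mul])
  · exact fin (-1) (by simp) (by rw [abs_of_nonpos hk]; ring)

lemma uniq {aE bE : EReal} {f : ℝ → ℝ} {J : Set ℝ}
    (hf : ContDiffOn ℝ (⊤ : ℕ∞) f (II aE bE)) (hpos : ∀ τ ∈ II aE bE, 0 < f τ)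
    {σ x : ℝ → ℝ} (hg : IsGeodesicOn aE bE f J σ x 0 1) (hlt : σ 0 < σ 1)
    (hcaus : |x 1 - x 0| ≤ ∫ τ in (σ 0)..(σ 1), (f τ)⁻¹) :
    ∃ s ∈ Icc (-1:ℝ) 1, ∃ c : ℝ, ∀ t ∈ Icc (0:ℝ) 1,
      ∫ τ in (σ 0)..(σ t), (WW f s τ)⁻¹ = c * t ∧
      x t = x 0 + ∫ τ in (σ 0)..(σ t), QQ f s τ := by
  obtain ⟨k, D, p, hpc, H⟩ := conserv hf hpos one_pos hg
  have h0 : (0:ℝ) ∈ Icc (0:ℝ) 1 := by norm_num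
  have h1 : (1:ℝ) ∈ Icc (0:ℝ) 1 := by norm_num
  have hD : D ≤ 0 := by
    by_contra hD
    push Not at hD
    exact no_spacelike hf hpos one_pos hg hcaus h0 (by rw [(H 0 h0).2.2.2]; exact hD)
  have hpos2 : 0 < -D + k ^ 2 := by
    rcases (add_nonneg (neg_nonneg.2 hD) (sq_nonneg k)).lt_or_eq with h | h
    · exact h
    · exfalso
      have hk : k ^ 2 = 0 := by nlinarith [sq_nonneg k]
      have hD0 : D = 0 := by linarith
      have := const_of (φ := σ) (t1 := 1) (fun t ht => by
        obtain ⟨-, hs, hs2, -⟩ := H t ht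
        have : p t = 0 := by
          rw [hk, hD0] at hs2
          simpa using hs2
        rwa [this] at hs) 1 h1
      linarith
  set c := Real.sqrt (-D + k ^ 2) with hc
  have hcpos : 0 < c := Real.sqrt_pos.2 hpos2
  have hc2 : c ^ 2 = -D + k ^ 2 := Real.sq_sqrt hpos2.le
  set s := k / c with hsdef
  have hk : k = c * s := by rw [hsdef]; field_simp
  have hs2 : s ^ 2 ≤ 1 := by
    rw [hsdef, div_pow, div_le_one (by positivity)]
    linarith
  have hs : s ∈ Icc (-1:ℝ) 1 := abs_le.1 (by rwa [sq_le_one_iff_abs_le_one] at hs2)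
  have hp2 : ∀ t ∈ Icc (0:ℝ) 1, p t ^ 2 = (c * WW f s (σ t)) ^ 2 := by
    intro t ht
    obtain ⟨-, -, h3, -⟩ := H t ht
    rw [mul_pow, WW_sq hs (hpos _ (hg.mem_base t ht)), h3]
    unfold NN
    have : D = k ^ 2 - c ^ 2 := by linarith
    rw [this, hk]
    ring
  have hWp : ∀ t ∈ Icc (0:ℝ) 1, 0 < WW f s (σ t) := fun t ht =>
    WW_pos hs (hpos _ (hg.mem_base t ht))
  have hpn : ∀ t ∈ Icc (0:ℝ) 1, p t ≠ 0 := by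
    intro t ht h
    have := hp2 t ht
    rw [h] at this
    have h5 := mul_pos hcpos (hWp t ht)
    have := pow_pos h5 2
    linarith
  have hpp : ∀ t ∈ Icc (0:ℝ) 1, 0 < p t := by
    rcases sign_of hpc hpn with h | h
    · exact h
    · exfalso
      have := strictMono_of (φ := fun t => - σ t) (φ' := fun t => - p t)
        (fun t ht => (H t ht).2.1.neg) (fun t ht => neg_pos.2 (h t ht)) h0 h1 one_pos
      simp only at this
      linarith
  have hpe : ∀ t ∈ Icc (0:ℝ) 1, p t = c * WW f s (σ t) := fun t ht =>
    (pow_left_inj₀ (hpp t ht).le (mul_pos hcpos (hWp t ht)).le two_ne_zero).1 (hp2 t ht)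
  refine ⟨s, hs, c, fun t ht => ⟨?_, ?_⟩⟩
  · have := const_of (φ := fun t => (∫ τ in (σ 0)..(σ t), (WW f s τ)⁻¹) - c * t) (t1 := 1) (by
      intro t ht
      have h3 := (ftc (isOpen_II aE bE) (ordConn_II aE bE) (WWinv_cont hf hpos hs)
        (hg.mem_base 0 h0) (hg.mem_base t ht)).comp_hasDerivWithinAt t (H t ht).2.1
      have := h3.sub ((hasDerivWithinAt_id t (Icc 0 1)).const_mul c)
      convert! this using 1
      rw [hpe t ht]
      have := (hWp t ht).ne'
      field_simp
      simp) t ht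
    simp only [intervalIntegral.integral_same] at this
    linarith
  · have := const_of (φ := fun t => (∫ τ in (σ 0)..(σ t), QQ f s τ) - x t) (t1 := 1) (by
      intro t ht
      have h3 := (ftc (isOpen_II aE bE) (ordConn_II aE bE) (QQ_cont hf hpos hs)
        (hg.mem_base 0 h0) (hg.mem_base t ht)).comp_hasDerivWithinAt t (H t ht).2.1
      have := h3.sub (H t ht).1
      convert! this using 1
      rw [hpe t ht, hk]
      have := (hWp t ht).ne'
      have := (hpos _ (hg.mem_base t ht)).ne'
      unfold QQ
      field_simp
      simp) t ht
    simp only [intervalIntegral.integral_same] at this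
    linarith

lemma WW_deriv {f : ℝ → ℝ} {s τ f' : ℝ} (hs : s ∈ Icc (-1:ℝ) 1) (hf : 0 < f τ)
    (hd : HasDerivAt f f' τ) :
    HasDerivAt (WW f s) (-(s ^ 2 * f') / ((f τ) ^ 3 * WW f s τ)) τ := by
  have hW := WW_pos hs hf
  have h1 : HasDerivAt (NN f s) (s ^ 2 * (-(2 * f τ * f') / ((f τ) ^ 2) ^ 2)) τ := by
    have h2 : HasDerivAt (fun u => (f u) ^ 2) (2 * f τ * f') τ := by
      simpa using! hd.pow 2
    exact ((h2.inv (pow_pos hf 2).ne').const_mul (s ^ 2)).const_add (1 - s ^ 2)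
  have h3 : HasDerivAt (WW f s)
      ((s ^ 2 * (-(2 * f τ * f') / ((f τ) ^ 2) ^ 2)) / (2 * WW f s τ)) τ :=
    h1.sqrt (NN_pos hs hf).ne'
  convert! h3 using 1
  field_simp

lemma exist {aE bE : EReal} {f : ℝ → ℝ} {J : Set ℝ}
    (hf : ContDiffOn ℝ (⊤ : ℕ∞) f (II aE bE)) (hpos : ∀ τ ∈ II aE bE, 0 < f τ)
    (hJ : OrdConnected J) {a b x0 x1 : ℝ} (hab : a < b) (ha : a ∈ II aE bE) (hb : b ∈ II aE bE)
    (hx0 : x0 ∈ J) (hx1 : x1 ∈ J) {s : ℝ} (hs : s ∈ Icc (-1:ℝ) 1)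
    (hsx : ∫ τ in a..b, QQ f s τ = x1 - x0) :
    ∃ (σ x : ℝ → ℝ) (C : ℝ), 0 < C ∧ IsGeodesicOn aE bE f J σ x 0 1 ∧ σ 0 = a ∧ x 0 = x0 ∧
      σ 1 = b ∧ x 1 = x1 ∧ ∀ t ∈ Icc (0:ℝ) 1, σ t ∈ II aE bE ∧
        derivWithin σ (Icc 0 1) t = C * WW f s (σ t) ∧
        derivWithin x (Icc 0 1) t = C * s / (f (σ t)) ^ 2 := by
  have hsub : Icc a b ⊆ II aE bE := (ordConn_II aE bE).out ha hb
  have hWp : ∀ τ ∈ II aE bE, 0 < WW f s τ := fun τ hτ => WW_pos hs (hpos τ hτ)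
  have hWc := WW_contDiff hf hpos hs
  set C := ∫ τ in a..b, (WW f s τ)⁻¹ with hC
  have hCpos : 0 < C := by
    apply intervalIntegral.intervalIntegral_pos_of_pos_on _ _ hab
    · apply ContinuousOn.intervalIntegrable
      rw [uIcc_of_le hab.le]
      exact (WWinv_cont hf hpos hs).mono hsub
    · intro τ hτ
      exact inv_pos.2 (hWp τ (hsub (Ioo_subset_Icc_self hτ)))
  obtain ⟨σ, hσ0, hσ1, hσ⟩ := inv_exists (w := fun τ => C * WW f s τ) hab
    (continuousOn_const.mul (hWc.continuousOn.mono hsub))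
    (fun u hu => mul_pos hCpos (hWp u (hsub hu))) (by
      simp only [mul_inv]
      rw [intervalIntegral.integral_const_mul, ← hC, inv_mul_cancel₀ hCpos.ne'])
  have hmem : ∀ t ∈ Icc (0:ℝ) 1, σ t ∈ II aE bE := fun t ht => hsub (hσ t ht).1
  have hud : UniqueDiffOn ℝ (Icc (0:ℝ) 1) := uniqueDiffOn_Icc one_pos
  have h0 : (0:ℝ) ∈ Icc (0:ℝ) 1 := by norm_num
  have h1 : (1:ℝ) ∈ Icc (0:ℝ) 1 := by norm_num
  set x : ℝ → ℝ := fun t => x0 + ∫ τ in a..(σ t), QQ f s τ with hx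
  have hxd : ∀ t ∈ Icc (0:ℝ) 1,
      HasDerivWithinAt x (C * s / (f (σ t)) ^ 2) (Icc 0 1) t := by
    intro t ht
    have h3 := ((ftc (isOpen_II aE bE) (ordConn_II aE bE) (QQ_cont hf hpos hs)
        ha (hmem t ht)).comp_hasDerivWithinAt t (hσ t ht).2).const_add x0
    convert! h3 using 1
    have := (hWp _ (hmem t ht)).ne'
    have := (hpos _ (hmem t ht)).ne'
    unfold QQ
    field_simp
  have hx00 : x 0 = x0 := by simp [hx, hσ0]
  have hx11 : x 1 = x1 := by
    simp only [hx, hσ1, hsx]; ring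
  have hσ' : ∀ t ∈ Icc (0:ℝ) 1, derivWithin σ (Icc 0 1) t = C * WW f s (σ t) := fun t ht =>
    (hσ t ht).2.derivWithin (hud t ht)
  have hx' : ∀ t ∈ Icc (0:ℝ) 1, derivWithin x (Icc 0 1) t = C * s / (f (σ t)) ^ 2 := fun t ht =>
    (hxd t ht).derivWithin (hud t ht)
  have hfd : ∀ t ∈ Icc (0:ℝ) 1, HasDerivAt f (deriv f (σ t)) (σ t) := fun t ht =>
    ((hf.contDiffAt ((isOpen_II aE bE).mem_nhds (hmem t ht))).differentiableAt
      (by norm_num)).hasDerivAt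
  have hmaps : MapsTo σ (Icc 0 1) (II aE bE) := hmem
  have h2 : (2 : WithTop ℕ∞) = 1 + 1 := by norm_num
  have h01 : (1 : WithTop ℕ∞) = 0 + 1 := by norm_num
  have hσC0 : ContDiffOn ℝ 0 σ (Icc 0 1) :=
    contDiffOn_zero.2 (fun t ht => (hσ t ht).2.continuousWithinAt)
  have hcomp : ∀ n : WithTop ℕ∞, n ≤ ((⊤ : ℕ∞) : WithTop ℕ∞) → ContDiffOn ℝ n σ (Icc 0 1) →
      ContDiffOn ℝ n (derivWithin σ (Icc 0 1)) (Icc 0 1) := by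
    intro n hn h
    refine ContDiffOn.congr (f := fun t => C * WW f s (σ t)) ?_ hσ'
    exact contDiffOn_const.mul ((hWc.of_le hn).comp h hmaps)
  have hσdiff : DifferentiableOn ℝ σ (Icc 0 1) :=
    fun t ht => (hσ t ht).2.differentiableWithinAt
  have hσC1 : ContDiffOn ℝ 1 σ (Icc 0 1) := by
    rw [h01, contDiffOn_succ_iff_derivWithin hud]
    exact ⟨hσdiff, by simp, hcomp 0 (by simp) hσC0⟩
  have h1top : (1 : WithTop ℕ∞) ≤ ((⊤ : ℕ∞) : WithTop ℕ∞) := by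
    exact_mod_cast (le_top : (1 : ℕ∞) ≤ ⊤)
  refine ⟨σ, x, C, hCpos, ⟨hmem, ?_, ?_, ?_, ?_, ?_⟩, hσ0, hx00, hσ1, hx11,
    fun t ht => ⟨hmem t ht, hσ' t ht, hx' t ht⟩⟩
  · intro t ht
    rcases le_total 0 s with hs0 | hs0
    · have hm := mono_of hxd (fun t ht => by
        have := hpos _ (hmem t ht)
        positivity)
      refine hJ.out hx0 hx1 ⟨?_, ?_⟩
      · rw [← hx00]; exact hm h0 ht ht.1
      · rw [← hx11]; exact hm ht h1 ht.2
    · have hm := mono_of (fun t ht => (hxd t ht).neg) (fun t ht => by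
        have := hpos _ (hmem t ht)
        rw [← neg_div, ← mul_neg]
        have : 0 ≤ -s := by linarith
        positivity)
      refine hJ.out hx1 hx0 ⟨?_, ?_⟩
      · rw [← hx11]; exact neg_le_neg_iff.1 (hm ht h1 ht.2)
      · rw [← hx00]; exact neg_le_neg_iff.1 (hm h0 ht ht.1)
  · rw [h2, contDiffOn_succ_iff_derivWithin hud]
    exact ⟨hσdiff, by simp, hcomp 1 h1top hσC1⟩
  · rw [h2, contDiffOn_succ_iff_derivWithin hud]
    refine ⟨fun t ht => (hxd t ht).differentiableWithinAt, by simp, ?_⟩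
    refine ContDiffOn.congr (f := fun t => C * s / (f (σ t)) ^ 2) ?_ hx'
    exact contDiffOn_const.div (((hf.of_le h1top).comp hσC1 hmaps).pow 2)
      (fun t ht => (pow_pos (hpos _ (hmem t ht)) 2).ne')
  · intro t ht
    rw [derivWithin_congr hσ' (hσ' t ht), hx' t ht]
    have hfp := hpos _ (hmem t ht)
    have hW := hWp _ (hmem t ht)
    have h3 := ((WW_deriv hs hfp (hfd t ht)).comp_hasDerivWithinAt t (hσ t ht).2).const_mul C
    have h4 : derivWithin (fun t => C * WW f s (σ t)) (Icc 0 1) t = _ :=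
      h3.derivWithin (hud t ht)
    rw [h4]
    field_simp
  · intro t ht
    rw [derivWithin_congr hx' (hx' t ht), hx' t ht, hσ' t ht]
    have hfp := hpos _ (hmem t ht)
    have hW := hWp _ (hmem t ht)
    have h5 := (((hfd t ht).comp_hasDerivWithinAt t (hσ t ht).2).pow 2)
    have h3 := (hasDerivWithinAt_const t (Icc (0:ℝ) 1) (C * s)).div h5 (pow_pos hfp 2).ne'
    have h4 : derivWithin (fun t => C * s / (f (σ t)) ^ 2) (Icc 0 1) t = _ :=
      h3.derivWithin (hud t ht)
    rw [h4]
    simp only [Pi.pow_apply, Function.comp, Nat.add_one_sub_one, Nat.cast_ofNat, pow_one]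
    field_simp
    ring

end GRWaux

/-- If `(τ0,x0) ≠ (τ0',x0')`, `τ0 ≤ τ0'` and
`∫_{τ0}^{τ0'} f⁻¹ ≥ |x0' - x0|` (the points are causally related), then there is exactly
one geodesic `γ : [0,1] → M` joining them; it is causal — timelike when the inequality is
strict, lightlike when equality holds — and no spacelike geodesic joins the two points. -/
theorem causally_related_unique_geodesic
    (aE bE : EReal) (hab : aE < bE) (f : ℝ → ℝ)
    (hf : ContDiffOn ℝ (⊤ : ℕ∞) f (II aE bE)) (hfpos : ∀ τ ∈ II aE bE, 0 < f τ)
    (J : Set ℝ) (hJ : ∃ c d : EReal, c < d ∧ J = {x : ℝ | c < (x : EReal) ∧ (x : EReal) < d})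
    (τ0 x0 τ0' x0' : ℝ) (hτ0 : τ0 ∈ II aE bE) (hτ0' : τ0' ∈ II aE bE)
    (hx0 : x0 ∈ J) (hx0' : x0' ∈ J)
    (hne : (τ0, x0) ≠ (τ0', x0')) (hle : τ0 ≤ τ0')
    (hcaus : |x0' - x0| ≤ ∫ τ in τ0..τ0', (f τ)⁻¹) :
    (∃ σ x : ℝ → ℝ, IsGeodesicOn aE bE f J σ x 0 1 ∧
      σ 0 = τ0 ∧ x 0 = x0 ∧ σ 1 = τ0' ∧ x 1 = x0' ∧
      (∀ t ∈ Icc (0:ℝ) 1, energyW f σ x 0 1 t ≤ 0) ∧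
      (|x0' - x0| < (∫ τ in τ0..τ0', (f τ)⁻¹) →
        ∀ t ∈ Icc (0:ℝ) 1, energyW f σ x 0 1 t < 0) ∧
      ((∫ τ in τ0..τ0', (f τ)⁻¹) = |x0' - x0| →
        ∀ t ∈ Icc (0:ℝ) 1, energyW f σ x 0 1 t = 0 ∧ velW σ x 0 1 t ≠ 0) ∧
      (∀ σ' x' : ℝ → ℝ, IsGeodesicOn aE bE f J σ' x' 0 1 →
        σ' 0 = τ0 → x' 0 = x0 → σ' 1 = τ0' → x' 1 = x0' →
        EqOn σ σ' (Icc 0 1) ∧ EqOn x x' (Icc 0 1))) ∧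
    (∀ (σ' x' : ℝ → ℝ) (t1 : ℝ), 0 < t1 → IsGeodesicOn aE bE f J σ' x' 0 t1 →
      σ' 0 = τ0 → x' 0 = x0 → σ' t1 = τ0' → x' t1 = x0' →
      ¬ ∀ t ∈ Icc 0 t1, 0 < energyW f σ' x' 0 t1 t) := by
  have hlt : τ0 < τ0' := by
    refine lt_of_le_of_ne hle fun heq => hne ?_
    subst heq
    rw [intervalIntegral.integral_same] at hcaus
    have := abs_nonpos_iff.1 hcaus
    rw [sub_eq_zero.1 this]
  have hsub : Icc τ0 τ0' ⊆ II aE bE := (GRWaux.ordConn_II aE bE).out hτ0 hτ0'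
  have hJo : OrdConnected J := by
    obtain ⟨c, d, -, rfl⟩ := hJ
    exact GRWaux.ordConn_II c d
  have hmono := GRWaux.Phi_strictMono hf hfpos hlt hsub
  have hP1 := GRWaux.Phi_one (s := 1) hfpos hlt hsub (by norm_num)
  have hPm1 := GRWaux.Phi_one (s := -1) hfpos hlt hsub (by norm_num)
  constructor
  · obtain ⟨s, hs, hsx⟩ := intermediate_value_Icc (by norm_num)
      (GRWaux.Phi_cont hf hfpos hlt hsub)
      (show x0' - x0 ∈ Icc _ _ from by
        simp only [hP1, hPm1]
        have := abs_le.1 hcaus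
        constructor <;> linarith)
    simp only at hsx
    obtain ⟨σ, x, C, hC, hg, hσ0, hx0e, hσ1, hx1e, hd⟩ :=
      GRWaux.exist hf hfpos hJo hlt hτ0 hτ0' hx0 hx0' hs hsx
    have hen : ∀ t ∈ Icc (0:ℝ) 1, energyW f σ x 0 1 t = -(C ^ 2 * (1 - s ^ 2)) := by
      intro t ht
      obtain ⟨hm, h1, h2⟩ := hd t ht
      have hfp := hfpos _ hm
      unfold energyW
      rw [h1, h2, mul_pow, GRWaux.WW_sq hs hfp]
      unfold GRWaux.NN
      field_simp
      ring
    have hs2 : s ^ 2 ≤ 1 := by nlinarith [hs.1, hs.2]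
    refine ⟨σ, x, hg, hσ0, hx0e, hσ1, hx1e, ?_, ?_, ?_, ?_⟩
    · intro t ht
      rw [hen t ht]
      have : 0 ≤ C ^ 2 * (1 - s ^ 2) := mul_nonneg (by positivity) (by linarith)
      linarith
    · intro hstrict t ht
      rw [hen t ht]
      have hs3 : s ^ 2 < 1 := by
        refine lt_of_le_of_ne hs2 fun h1 => ?_
        have h2 := GRWaux.Phi_one hfpos hlt hsub h1
        rw [← hsx, h2, abs_mul, show |s| = 1 from (sq_eq_sq₀ (abs_nonneg s) zero_le_one).1 (by rw [sq_abs, h1, one_pow]), one_mul] at hstrict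
        have := le_abs_self (∫ τ in τ0..τ0', (f τ)⁻¹)
        linarith
      have : 0 < C ^ 2 * (1 - s ^ 2) := mul_pos (by positivity) (by linarith)
      linarith
    · intro heq t ht
      have hs3 : s ^ 2 = 1 := by
        rcases le_total 0 (x0' - x0) with h | h
        · rw [abs_of_nonneg h] at heq
          have : s = 1 := hmono.injOn hs (right_mem_Icc.2 (by norm_num)) (by
            simp only [hP1, hsx]; linarith)
          rw [this]; norm_num
        · rw [abs_of_nonpos h] at heq
          have : s = -1 := hmono.injOn hs (left_mem_Icc.2 (by norm_num)) (by
            simp only [hPm1, hsx]; linarith)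
          rw [this]; norm_num
      refine ⟨by rw [hen t ht, hs3]; ring, fun hv => ?_⟩
      obtain ⟨hm, h1, -⟩ := hd t ht
      have h3 : derivWithin σ (Icc 0 1) t = 0 := congrArg Prod.fst hv
      rw [h1] at h3
      exact (mul_pos hC (GRWaux.WW_pos hs (hfpos _ hm))).ne' h3
    · intro σ' x' hg' hσ0' hx0e' hσ1' hx1e'
      obtain ⟨r, hr, c, H⟩ := GRWaux.uniq hf hfpos hg (by rw [hσ0, hσ1]; exact hlt)
        (by rw [hσ0, hσ1, hx0e, hx1e]; exact hcaus)
      obtain ⟨r', hr', c', H'⟩ := GRWaux.uniq hf hfpos hg' (by rw [hσ0', hσ1']; exact hlt)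
        (by rw [hσ0', hσ1', hx0e', hx1e']; exact hcaus)
      rw [hσ0, hx0e] at H
      rw [hσ0', hx0e'] at H'
      have h1 : (1:ℝ) ∈ Icc (0:ℝ) 1 := by norm_num
      have e1 := H 1 h1
      have e1' := H' 1 h1
      rw [hσ1, hx1e] at e1
      rw [hσ1', hx1e'] at e1'
      have hrr : r = r' := hmono.injOn hr hr' (by
        linarith [e1.2, e1'.2])
      subst hrr
      have hcc : c = c' := by
        have h5 := e1.1
        rw [e1'.1] at h5
        linarith
      subst hcc
      have hTm : ∀ u ∈ II aE bE, ∀ v ∈ II aE bE, u < v →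
          (∫ τ in τ0..u, (GRWaux.WW f r τ)⁻¹) < ∫ τ in τ0..v, (GRWaux.WW f r τ)⁻¹ := by
        intro u hu v hv huv
        have hs' : Icc u v ⊆ II aE bE := (GRWaux.ordConn_II aE bE).out hu hv
        exact GRWaux.strictMono_of (φ := fun u => ∫ τ in τ0..u, (GRWaux.WW f r τ)⁻¹)
          (φ' := fun τ => (GRWaux.WW f r τ)⁻¹)
          (fun w hw => (GRWaux.ftc (GRWaux.isOpen_II aE bE) (GRWaux.ordConn_II aE bE)
            (GRWaux.WWinv_cont hf hfpos hr) hτ0 (hs' hw)).hasDerivWithinAt)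
          (fun w hw => inv_pos.2 (GRWaux.WW_pos hr (hfpos w (hs' hw))))
          (left_mem_Icc.2 huv.le) (right_mem_Icc.2 huv.le) huv
      have hσe : EqOn σ σ' (Icc 0 1) := by
        intro t ht
        have h6 : (∫ τ in τ0..σ t, (GRWaux.WW f r τ)⁻¹) = ∫ τ in τ0..σ' t, (GRWaux.WW f r τ)⁻¹ := by
          rw [(H t ht).1, (H' t ht).1]
        rcases lt_trichotomy (σ t) (σ' t) with h | h | h
        · exact absurd h6 (hTm _ (hg.mem_base t ht) _ (hg'.mem_base t ht) h).ne
        · exact h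
        · exact absurd h6 (hTm _ (hg'.mem_base t ht) _ (hg.mem_base t ht) h).ne'
      refine ⟨hσe, fun t ht => ?_⟩
      rw [(H t ht).2, (H' t ht).2, hσe ht]
  · intro σ' x' t1 ht1 hg' hσ0' hx0e' hσ1' hx1e' hE
    exact GRWaux.no_spacelike hf hfpos ht1 hg' (by rw [hσ0', hσ1', hx0e', hx1e']; exact hcaus)
      (left_mem_Icc.2 ht1.le) (hE 0 (left_mem_Icc.2 ht1.le))
end
end

section
/- Fix τ0 ∈ (a,b), points x0, x0' ∈ J with L := |x0' − x0| > 0, and real numbers D⁻ < D⁺ < G(τ0). Assume that for every D ∈ [D⁻, D⁺] there exists τ(D) ∈ (τ0, b) such that G(τ) > D for all τ ∈ [τ0, τ(D)] and ∫_{τ0}^{τ(D)} f(τ)^{−2} (G(τ) − D)^{−1/2} dτ = L. Then τ(D) is uniquely determined for each D, the map D ↦ τ(D) is continuous and strictly decreasing on [D⁻, D⁺], and for every τ' ∈ [τ(D⁺), τ(D⁻)] there exists a geodesic of g^f joining (τ0, x0) and (τ', x0'). -/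
open Set Filter MeasureTheory Topology
open scoped ENNReal NNReal

noncomputable section

open Set Filter MeasureTheory Topology GRW
open scoped ENNReal

lemma aux_inv_flow (τ0 m : ℝ) (ψ : ℝ → ℝ) (hψ : Continuous ψ) (hm : 0 < m) (hle : ∀ τ, m ≤ ψ τ) :
    ∃ σ : ℝ → ℝ, StrictMono σ ∧ (∀ t, HasDerivAt σ (ψ (σ t))⁻¹ t) ∧
      ∀ τ, σ (∫ u in τ0..τ, ψ u) = τ := by
  set t : ℝ → ℝ := fun τ => ∫ u in τ0..τ, ψ u with ht
  have hd : ∀ τ, HasDerivAt t (ψ τ) τ := fun τ => (hψ.integral_hasStrictDerivAt τ0 τ).hasDerivAt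
  have hmono : StrictMono t := strictMono_of_deriv_pos (fun τ => by
    rw [(hd τ).deriv]; exact hm.trans_le (hle τ))
  have hcont : Continuous t := continuous_iff_continuousAt.2 fun τ => (hd τ).continuousAt
  have hmono2 : Monotone (fun τ => t τ - m * τ) := by
    apply monotone_of_deriv_nonneg
    · intro τ
      exact ((hd τ).sub ((hasDerivAt_id τ).const_mul m)).differentiableAt
    · intro τ
      have := ((hd τ).sub ((hasDerivAt_id τ).const_mul m)).deriv
      have e : (fun τ => t τ - m * τ) = (t - fun y => m * id y) := by ext; simp
      rw [e, this]
      have := hle τ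
      linarith
  have htop : Tendsto t atTop atTop := by
    refine tendsto_atTop_mono' (f₁ := fun τ => t 0 + m * τ) atTop ?_ ?_
    · filter_upwards [eventually_ge_atTop 0] with τ hτ
      have := hmono2 hτ
      simp only at this
      linarith
    · exact tendsto_atTop_add_const_left _ _ (tendsto_id.const_mul_atTop hm)
  have hbot : Tendsto t atBot atBot := by
    refine tendsto_atBot_mono' (f₁ := fun τ => t 0 + m * τ) atBot ?_ ?_
    · filter_upwards [eventually_le_atBot 0] with τ hτ
      have := hmono2 hτ
      simp only at this
      linarith
    · exact tendsto_atBot_add_const_left _ _ (tendsto_id.const_mul_atBot hm)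
  have hsurj := hcont.surjective htop hbot
  let e := hmono.orderIsoOfSurjective t hsurj
  refine ⟨e.symm, e.symm.strictMono, ?_, ?_⟩
  · intro s
    refine HasDerivAt.of_local_left_inverse (f := t) e.symm.continuous.continuousAt (hd _)
      (hm.trans_le (hle _)).ne' (Eventually.of_forall fun y => ?_)
    exact e.apply_symm_apply y
  · intro τ
    exact e.symm_apply_apply τ

lemma aux_contDiffOn_succ {n : ℕ} {t1 : ℝ} (ht1 : 0 < t1) {σ v : ℝ → ℝ}
    (hσ : ∀ t ∈ Icc 0 t1, HasDerivWithinAt σ (v t) (Icc 0 t1) t)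
    (hv : ContDiffOn ℝ n v (Icc 0 t1)) : ContDiffOn ℝ (n + 1) σ (Icc 0 t1) := by
  have hu := uniqueDiffOn_Icc ht1
  rw [contDiffOn_succ_iff_derivWithin hu]
  refine ⟨fun t ht => (hσ t ht).differentiableWithinAt, by simp, hv.congr fun t ht => ?_⟩
  exact (hσ t ht).derivWithin (hu t ht)

lemma aux_isOpen (aE bE : EReal) : IsOpen (II aE bE) := by
  have : II aE bE = (fun τ : ℝ => (τ : EReal)) ⁻¹' Ioo aE bE := rfl
  rw [this]
  exact isOpen_Ioo.preimage continuous_coe_real_ereal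

lemma aux_ordConn (aE bE : EReal) : OrdConnected (II aE bE) := by
  have : II aE bE = (fun τ : ℝ => (τ : EReal)) ⁻¹' Ioo aE bE := rfl
  rw [this]
  exact ordConnected_Ioo.preimage_mono EReal.coe_strictMono.monotone

lemma aux_G_contDiff {aE bE : EReal} {f : ℝ → ℝ}
    (hf : ContDiffOn ℝ (⊤ : ℕ∞) f (II aE bE)) (hfpos : ∀ τ ∈ II aE bE, 0 < f τ) :
    ContDiffOn ℝ (⊤ : ℕ∞) (G f) (II aE bE) :=
  (hf.pow 2).inv fun τ hτ => (pow_pos (hfpos τ hτ) 2).ne'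

lemma aux_G_deriv {aE bE : EReal} {f : ℝ → ℝ}
    (hf : ContDiffOn ℝ (⊤ : ℕ∞) f (II aE bE)) (hfpos : ∀ τ ∈ II aE bE, 0 < f τ)
    {τ : ℝ} (hτ : τ ∈ II aE bE) : HasDerivAt (G f) (-(2 * deriv f τ / f τ ^ 3)) τ := by
  have h1 : HasDerivAt f (deriv f τ) τ :=
    ((hf.contDiffAt ((aux_isOpen aE bE).mem_nhds hτ)).differentiableAt (by simp)).hasDerivAt
  have h0 := (hfpos τ hτ).ne'
  have := (h1.pow 2).inv (pow_ne_zero 2 h0)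
  refine HasDerivAt.congr_deriv (f := G f) this ?_
  push_cast
  simp only [Pi.pow_apply]
  field_simp

lemma aux_geod {aE bE : EReal} {f : ℝ → ℝ}
    (hf : ContDiffOn ℝ (⊤ : ℕ∞) f (II aE bE)) (hfpos : ∀ τ ∈ II aE bE, 0 < f τ)
    {J : Set ℝ} (hJ : OrdConnected J)
    {τ0 x0 x0' τ' D s : ℝ} (hx0 : x0 ∈ J) (hx0' : x0' ∈ J) (hs : s ^ 2 = 1)
    (hlt : τ0 < τ') (hsub : Icc τ0 τ' ⊆ II aE bE) (hD : ∀ τ ∈ Icc τ0 τ', D < G f τ)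
    (hint : x0' = x0 + s * ∫ τ in τ0..τ', (f τ ^ 2 * Real.sqrt (G f τ - D))⁻¹) :
    ∃ (σ x : ℝ → ℝ) (t1 : ℝ), 0 < t1 ∧ IsGeodesicOn aE bE f J σ x 0 t1 ∧
          σ 0 = τ0 ∧ x 0 = x0 ∧ σ t1 = τ' ∧ x t1 = x0' := by
  have hGc : ContinuousOn (G f) (Icc τ0 τ') := (aux_G_contDiff hf hfpos).continuousOn.mono hsub
  let c : ℝ → ℝ := fun τ => max τ0 (min τ τ')
  have hc : Continuous c := by fun_prop
  have hcmem : ∀ τ, c τ ∈ Icc τ0 τ' := fun τ =>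
    ⟨le_max_left _ _, max_le hlt.le (min_le_right _ _)⟩
  have hcid : ∀ τ ∈ Icc τ0 τ', c τ = τ := fun τ hτ => by
    simp only [c]; rw [min_eq_left hτ.2, max_eq_right hτ.1]
  have hGcl : Continuous (fun τ => G f (c τ)) := hGc.comp_continuous hc hcmem
  let ψ : ℝ → ℝ := fun τ => (Real.sqrt (G f (c τ) - D))⁻¹
  have hsq : ∀ τ, 0 < Real.sqrt (G f (c τ) - D) := fun τ =>
    Real.sqrt_pos.2 (sub_pos.2 (hD _ (hcmem τ)))
  have hψ : Continuous ψ := by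
    refine Continuous.inv₀ (by fun_prop) fun τ => (hsq τ).ne'
  have hψpos : ∀ τ, 0 < ψ τ := fun τ => inv_pos.2 (hsq τ)
  obtain ⟨p, hp, hpm⟩ := isCompact_Icc.exists_isMinOn (nonempty_Icc.2 hlt.le)
    (hψ.continuousOn (s := Icc τ0 τ'))
  have hle : ∀ τ, ψ p ≤ ψ τ := fun τ => by
    have := hpm (hcmem τ)
    simp only [mem_ofPred_eq] at this
    refine this.trans_eq ?_
    simp only [ψ]; rw [hcid _ (hcmem τ)]
  obtain ⟨σ, hσm, hσd, hσi⟩ := aux_inv_flow τ0 (ψ p) ψ hψ (hψpos p) hle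
  have hσ0 : σ 0 = τ0 := by simpa using hσi τ0
  set t1 := ∫ u in τ0..τ', ψ u with ht1
  have hσ1 : σ t1 = τ' := hσi τ'
  have ht1p : 0 < t1 := by rw [← hσm.lt_iff_lt, hσ0, hσ1]; exact hlt
  have hσmem : ∀ t ∈ Icc 0 t1, σ t ∈ Icc τ0 τ' := fun t ht => by
    rw [← hσ0, ← hσ1]; exact ⟨hσm.monotone ht.1, hσm.monotone ht.2⟩
  let Φ : ℝ → ℝ := fun τ => ∫ u in τ0..τ, G f (c u) * ψ u
  have hΦd : ∀ τ, HasDerivAt Φ (G f (c τ) * ψ τ) τ := fun τ =>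
    ((hGcl.mul hψ).integral_hasStrictDerivAt τ0 τ).hasDerivAt
  have hΦ1 : Φ τ' = ∫ τ in τ0..τ', (f τ ^ 2 * Real.sqrt (G f τ - D))⁻¹ := by
    refine intervalIntegral.integral_congr fun τ hτ => ?_
    rw [uIcc_of_le hlt.le] at hτ
    simp only [ψ, hcid τ hτ]
    rw [mul_inv]; rfl
  have hΦm : Monotone Φ := monotone_of_deriv_nonneg (fun τ => (hΦd τ).differentiableAt)
    fun τ => by
      rw [(hΦd τ).deriv]
      exact mul_nonneg (inv_nonneg.2 (sq_nonneg _)) (hψpos τ).le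
  have hΦ0 : Φ τ0 = 0 := by simp [Φ]
  let x : ℝ → ℝ := fun t => x0 + s * Φ (σ t)
  have hx_0 : x 0 = x0 := by simp [x, hσ0, hΦ0]
  have hx_1 : x t1 = x0' := by simp only [x]; rw [hσ1, hΦ1, ← hint]
  have hσd' : ∀ t ∈ Icc 0 t1,
      HasDerivWithinAt σ (Real.sqrt (G f (σ t) - D)) (Icc 0 t1) t := fun t ht => by
    have := (hσd t).hasDerivWithinAt (s := Icc 0 t1)
    simpa only [ψ, inv_inv, hcid _ (hσmem t ht)] using this
  have hxd' : ∀ t ∈ Icc 0 t1, HasDerivWithinAt x (s * G f (σ t)) (Icc 0 t1) t := fun t ht => by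
    have := ((((hΦd (σ t)).comp t (hσd t)).const_mul s).const_add x0).hasDerivWithinAt
      (s := Icc 0 t1)
    rw [mul_assoc, mul_inv_cancel₀ (hψpos _).ne', mul_one, hcid _ (hσmem t ht)] at this
    exact this
  have hu := uniqueDiffOn_Icc ht1p
  have hmaps : MapsTo σ (Icc 0 t1) (Icc τ0 τ') := hσmem
  have hσc : ContDiffOn ℝ 0 σ (Icc 0 t1) := contDiffOn_zero.2
    fun t ht => (hσd' t ht).continuousWithinAt
  have hGσ : ∀ n : ℕ, ContDiffOn ℝ n σ (Icc 0 t1) →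
      ContDiffOn ℝ n (fun t => G f (σ t)) (Icc 0 t1) := fun n hn =>
    (((aux_G_contDiff hf hfpos).of_le (by exact_mod_cast le_top)).mono hsub).comp hn hmaps
  have hvσ : ∀ n : ℕ, ContDiffOn ℝ n σ (Icc 0 t1) →
      ContDiffOn ℝ n (fun t => Real.sqrt (G f (σ t) - D)) (Icc 0 t1) := fun n hn =>
    ((hGσ n hn).sub contDiffOn_const).sqrt fun t ht => (sub_pos.2 (hD _ (hσmem t ht))).ne'
  have hσ1' : ContDiffOn ℝ 1 σ (Icc 0 t1) := by
    have := aux_contDiffOn_succ (n := 0) ht1p hσd' (hvσ 0 (by exact_mod_cast hσc))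
    simpa using this
  have hσ2' : ContDiffOn ℝ 2 σ (Icc 0 t1) := by
    have := aux_contDiffOn_succ (n := 1) ht1p hσd' (hvσ 1 (by exact_mod_cast hσ1'))
    norm_num at this
    exact this
  have hx2' : ContDiffOn ℝ 2 x (Icc 0 t1) := by
    have := aux_contDiffOn_succ (n := 1) ht1p hxd'
      (contDiffOn_const.mul (hGσ 1 (by exact_mod_cast hσ1')))
    norm_num at this
    exact this
  have hGσd : ∀ t ∈ Icc 0 t1, HasDerivWithinAt (fun t => G f (σ t))
      (-(2 * deriv f (σ t) / f (σ t) ^ 3) * Real.sqrt (G f (σ t) - D)) (Icc 0 t1) t :=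
    fun t ht => (aux_G_deriv hf hfpos (hsub (hσmem t ht))).comp_hasDerivWithinAt t (hσd' t ht)
  have hsqd : ∀ t ∈ Icc 0 t1, HasDerivWithinAt (fun t => Real.sqrt (G f (σ t) - D))
      (-(deriv f (σ t) / f (σ t) ^ 3)) (Icc 0 t1) t := fun t ht => by
    have hpos := sub_pos.2 (hD _ (hσmem t ht))
    have := ((hGσd t ht).sub_const D).sqrt hpos.ne'
    convert this using 1
    have := (Real.sqrt_pos.2 hpos).ne'
    have := (hfpos _ (hsub (hσmem t ht))).ne'
    field_simp
  have eσ : ∀ t ∈ Icc 0 t1, derivWithin σ (Icc 0 t1) t = Real.sqrt (G f (σ t) - D) :=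
    fun t ht => (hσd' t ht).derivWithin (hu t ht)
  have ex : ∀ t ∈ Icc 0 t1, derivWithin x (Icc 0 t1) t = s * G f (σ t) :=
    fun t ht => (hxd' t ht).derivWithin (hu t ht)
  refine ⟨σ, x, t1, ht1p, ⟨fun t ht => hsub (hσmem t ht), fun t ht => ?_, hσ2', hx2', ?_, ?_⟩,
    hσ0, hx_0, hσ1, hx_1⟩
  · have h0 : 0 ≤ Φ (σ t) := hΦ0 ▸ hΦm (hσmem t ht).1
    have h1 : Φ (σ t) ≤ Φ τ' := hΦm (hσmem t ht).2
    have hx1e : x0' = x0 + s * Φ τ' := by rw [hΦ1]; exact hint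
    have : x t ∈ uIcc x0 x0' := by
      rw [mem_uIcc, hx1e]
      simp only [x]
      rcases eq_or_eq_neg_of_sq_eq_sq s 1 (by simpa using hs) with h | h
      · left; subst h; constructor <;> linarith
      · right; subst h; constructor <;> linarith
    exact hJ.uIcc_subset hx0 hx0' this
  · intro t ht
    rw [derivWithin_congr eσ (eσ t ht), (hsqd t ht).derivWithin (hu t ht), ex t ht, mul_pow, hs]
    have := (hfpos _ (hsub (hσmem t ht))).ne'
    simp only [G]
    field_simp
  · intro t ht
    rw [derivWithin_congr ex (ex t ht), ((hGσd t ht).const_mul s).derivWithin (hu t ht), ex t ht,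
      eσ t ht]
    have := (hfpos _ (hsub (hσmem t ht))).ne'
    generalize Real.sqrt (G f (σ t) - D) = w
    simp only [G]
    field_simp

lemma aux_phi_pos {f : ℝ → ℝ} {D τ : ℝ} (hf : 0 < f τ) (hD : D < G f τ) :
    0 < (f τ ^ 2 * Real.sqrt (G f τ - D))⁻¹ :=
  inv_pos.2 (mul_pos (pow_pos hf 2) (Real.sqrt_pos.2 (sub_pos.2 hD)))

lemma aux_phi_lt {f : ℝ → ℝ} {D D' τ : ℝ} (hf : 0 < f τ) (hDD : D < D') (hD : D' < G f τ) :
    (f τ ^ 2 * Real.sqrt (G f τ - D))⁻¹ < (f τ ^ 2 * Real.sqrt (G f τ - D'))⁻¹ := by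
  have h1 : Real.sqrt (G f τ - D') < Real.sqrt (G f τ - D) :=
    Real.sqrt_lt_sqrt (by linarith) (by linarith)
  have h2 : 0 < Real.sqrt (G f τ - D') := Real.sqrt_pos.2 (sub_pos.2 hD)
  have h3 : 0 < f τ ^ 2 := pow_pos hf 2
  exact inv_strictAnti₀ (mul_pos h3 h2) (mul_lt_mul_of_pos_left h1 h3)

lemma aux_phi_cont {aE bE : EReal} {f : ℝ → ℝ}
    (hf : ContDiffOn ℝ (⊤ : ℕ∞) f (II aE bE)) (hfpos : ∀ τ ∈ II aE bE, 0 < f τ)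
    {s : Set ℝ} {D : ℝ} (hs : s ⊆ II aE bE) (hD : ∀ τ ∈ s, D < G f τ) :
    ContinuousOn (fun τ => (f τ ^ 2 * Real.sqrt (G f τ - D))⁻¹) s := by
  have h1 : ContinuousOn f s := hf.continuousOn.mono hs
  have h2 : ContinuousOn (G f) s := (aux_G_contDiff hf hfpos).continuousOn.mono hs
  refine ContinuousOn.inv₀ ((h1.pow 2).mul (h2.sub continuousOn_const).sqrt) fun τ hτ => ?_
  exact (inv_pos.1 (aux_phi_pos (hfpos τ (hs hτ)) (hD τ hτ))).ne'

lemma aux_int_lt {aE bE : EReal} {f : ℝ → ℝ}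
    (hf : ContDiffOn ℝ (⊤ : ℕ∞) f (II aE bE)) (hfpos : ∀ τ ∈ II aE bE, 0 < f τ)
    {τ0 c d D : ℝ} (hc : τ0 ≤ c) (hcd : c < d) (hs : Icc τ0 d ⊆ II aE bE)
    (hD : ∀ τ ∈ Icc τ0 d, D < G f τ) :
    (∫ τ in τ0..c, (f τ ^ 2 * Real.sqrt (G f τ - D))⁻¹) <
      ∫ τ in τ0..d, (f τ ^ 2 * Real.sqrt (G f τ - D))⁻¹ := by
  have hcont := aux_phi_cont hf hfpos hs hD
  have i1 : IntervalIntegrable (fun τ => (f τ ^ 2 * Real.sqrt (G f τ - D))⁻¹) volume τ0 c :=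
    (hcont.mono (Icc_subset_Icc_right hcd.le)).intervalIntegrable_of_Icc hc
  have i2 : IntervalIntegrable (fun τ => (f τ ^ 2 * Real.sqrt (G f τ - D))⁻¹) volume c d :=
    (hcont.mono (Icc_subset_Icc_left hc)).intervalIntegrable_of_Icc hcd.le
  rw [← intervalIntegral.integral_add_adjacent_intervals i1 i2]
  have := intervalIntegral.intervalIntegral_pos_of_pos_on i2 (fun τ hτ => by
    have hm : τ ∈ Icc τ0 d := ⟨hc.trans hτ.1.le, hτ.2.le⟩
    exact aux_phi_pos (hfpos τ (hs hm)) (hD τ hm)) hcd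
  linarith

lemma aux_gap {aE bE : EReal} {f : ℝ → ℝ}
    (hf : ContDiffOn ℝ (⊤ : ℕ∞) f (II aE bE)) (hfpos : ∀ τ ∈ II aE bE, 0 < f τ)
    {τ0 c D : ℝ} (hc : τ0 ≤ c) (hs : Icc τ0 c ⊆ II aE bE)
    (hD : ∀ τ ∈ Icc τ0 c, D < G f τ) :
    ∃ d, D < d ∧ ∀ τ ∈ Icc τ0 c, d < G f τ := by
  have h2 : ContinuousOn (G f) (Icc τ0 c) := (aux_G_contDiff hf hfpos).continuousOn.mono hs
  obtain ⟨p, hp, hpm⟩ := isCompact_Icc.exists_isMinOn (nonempty_Icc.2 hc) h2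
  obtain ⟨d, hd1, hd2⟩ := exists_between (hD p hp)
  exact ⟨d, hd1, fun τ hτ => hd2.trans_le (hpm hτ)⟩

lemma aux_int_cont {aE bE : EReal} {f : ℝ → ℝ}
    (hf : ContDiffOn ℝ (⊤ : ℕ∞) f (II aE bE)) (hfpos : ∀ τ ∈ II aE bE, 0 < f τ)
    {τ0 c D : ℝ} (hc : τ0 ≤ c) (hs : Icc τ0 c ⊆ II aE bE)
    (hD : ∀ τ ∈ Icc τ0 c, D < G f τ) :
    ContinuousAt (fun D => ∫ τ in τ0..c, (f τ ^ 2 * Real.sqrt (G f τ - D))⁻¹) D := by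
  obtain ⟨d, hd, hdG⟩ := aux_gap hf hfpos hc hs hD
  have hI : Set.uIoc τ0 c ⊆ Icc τ0 c := by rw [uIoc_of_le hc]; exact Ioc_subset_Icc_self
  refine intervalIntegral.continuousAt_of_dominated_interval
    (bound := fun τ => (f τ ^ 2 * Real.sqrt (G f τ - d))⁻¹) ?_ ?_ ?_ ?_
  · filter_upwards [Iio_mem_nhds hd] with D' hD'
    exact ((aux_phi_cont hf hfpos hs fun τ hτ => lt_trans hD' (hdG τ hτ)).mono
      hI).aestronglyMeasurable measurableSet_uIoc
  · filter_upwards [Iio_mem_nhds hd] with D' hD'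
    refine Eventually.of_forall fun τ hτ => ?_
    have hm := hI hτ
    rw [Real.norm_of_nonneg (aux_phi_pos (hfpos τ (hs hm)) (lt_trans hD' (hdG τ hm))).le]
    exact (aux_phi_lt (hfpos τ (hs hm)) hD' (hdG τ hm)).le
  · exact (aux_phi_cont hf hfpos hs hdG).intervalIntegrable_of_Icc hc
  · refine Eventually.of_forall fun τ hτ => ?_
    have hm := hI hτ
    refine ContinuousAt.inv₀ (by fun_prop) ?_
    exact (inv_pos.1 (aux_phi_pos (hfpos τ (hs hm)) (hD τ hm))).ne'


/-- Fix `τ0 ∈ (a,b)`, `x0, x0' ∈ J` with `L = |x0'-x0| > 0` and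
`D⁻ < D⁺ < G(τ0)`. If for every `D ∈ [D⁻,D⁺]` there is `τ(D) ∈ (τ0,b)` with `G > D` on
`[τ0,τ(D)]` and `∫_{τ0}^{τ(D)} f⁻²(G−D)^{-1/2} = L`, then `τ(D)` is unique, depends
continuously and strictly decreasingly on `D ∈ [D⁻,D⁺]`, and every point `(τ',x0')` with
`τ' ∈ [τ(D⁺), τ(D⁻)]` is joined to `(τ0,x0)` by a geodesic of `g^f`. -/
theorem tau_of_D_continuous_and_connects
    (aE bE : EReal) (hab : aE < bE) (f : ℝ → ℝ)
    (hf : ContDiffOn ℝ (⊤ : ℕ∞) f (II aE bE)) (hfpos : ∀ τ ∈ II aE bE, 0 < f τ)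
    (J : Set ℝ) (hJ : ∃ c d : EReal, c < d ∧ J = {x : ℝ | c < (x : EReal) ∧ (x : EReal) < d})
    (τ0 x0 x0' : ℝ) (hτ0 : τ0 ∈ II aE bE) (hx0 : x0 ∈ J) (hx0' : x0' ∈ J)
    (hL : 0 < |x0' - x0|)
    (Dm Dp : ℝ) (hDmp : Dm < Dp) (hDp : Dp < G f τ0)
    (hyp : ∀ D ∈ Icc Dm Dp, ∃ τD : ℝ, τ0 < τD ∧ (τD : EReal) < bE ∧
      (∀ τ ∈ Icc τ0 τD, D < G f τ) ∧
      (∫ τ in τ0..τD, (f τ ^ 2 * Real.sqrt (G f τ - D))⁻¹) = |x0' - x0|) :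
    ∃ T : ℝ → ℝ,
      (∀ D ∈ Icc Dm Dp,
        (τ0 < T D ∧ ((T D : ℝ) : EReal) < bE ∧ (∀ τ ∈ Icc τ0 (T D), D < G f τ) ∧
          (∫ τ in τ0..(T D), (f τ ^ 2 * Real.sqrt (G f τ - D))⁻¹) = |x0' - x0|) ∧
        ∀ τD' : ℝ, τ0 < τD' → (τD' : EReal) < bE → (∀ τ ∈ Icc τ0 τD', D < G f τ) →
          (∫ τ in τ0..τD', (f τ ^ 2 * Real.sqrt (G f τ - D))⁻¹) = |x0' - x0| →
          τD' = T D) ∧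
      ContinuousOn T (Icc Dm Dp) ∧ StrictAntiOn T (Icc Dm Dp) ∧
      ∀ τ' ∈ Icc (T Dp) (T Dm),
        ∃ (σ x : ℝ → ℝ) (t1 : ℝ), 0 < t1 ∧ IsGeodesicOn aE bE f J σ x 0 t1 ∧
          σ 0 = τ0 ∧ x 0 = x0 ∧ σ t1 = τ' ∧ x t1 = x0' := by
  have hsub : ∀ c : ℝ, (c : EReal) < bE → Icc τ0 c ⊆ II aE bE := fun c hc τ hτ =>
    ⟨hτ0.1.trans_le (EReal.coe_le_coe_iff.2 hτ.1), (EReal.coe_le_coe_iff.2 hτ.2).trans_lt hc⟩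
  have hJo : OrdConnected J := by
    obtain ⟨c, d, -, rfl⟩ := hJ
    exact aux_ordConn c d
  choose! T hT using hyp
  have huniq : ∀ D ∈ Icc Dm Dp, ∀ τD' : ℝ, τ0 < τD' → (τD' : EReal) < bE →
      (∀ τ ∈ Icc τ0 τD', D < G f τ) →
      (∫ τ in τ0..τD', (f τ ^ 2 * Real.sqrt (G f τ - D))⁻¹) = |x0' - x0| → τD' = T D := by
    intro D hD τ' h1 h2 h3 h4
    obtain ⟨t1, t2, t3, t4⟩ := hT D hD
    rcases lt_trichotomy τ' (T D) with h | h | h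
    · have := aux_int_lt hf hfpos h1.le h (hsub _ t2) t3
      linarith
    · exact h
    · have := aux_int_lt hf hfpos t1.le h (hsub _ h2) h3
      linarith
  have hanti : StrictAntiOn T (Icc Dm Dp) := by
    intro D1 h1 D2 h2 h12
    by_contra hcon
    push Not at hcon
    obtain ⟨s1, s2, s3, s4⟩ := hT D1 h1
    obtain ⟨t1, t2, t3, t4⟩ := hT D2 h2
    have hss : Icc τ0 (T D1) ⊆ Icc τ0 (T D2) := Icc_subset_Icc_right hcon
    have i1 : (∫ τ in τ0..T D1, (f τ ^ 2 * Real.sqrt (G f τ - D1))⁻¹) <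
        ∫ τ in τ0..T D1, (f τ ^ 2 * Real.sqrt (G f τ - D2))⁻¹ := by
      refine intervalIntegral.integral_lt_integral_of_continuousOn_of_le_of_exists_lt s1
        (aux_phi_cont hf hfpos (hsub _ s2) s3)
        (aux_phi_cont hf hfpos (hsub _ s2) fun τ hτ => t3 τ (hss hτ)) ?_ ?_
      · intro τ hτ
        have hm := Ioc_subset_Icc_self hτ
        exact (aux_phi_lt (hfpos τ (hsub _ s2 hm)) h12 (t3 τ (hss hm))).le
      · have hm : τ0 ∈ Icc τ0 (T D1) := ⟨le_rfl, s1.le⟩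
        exact ⟨τ0, hm, aux_phi_lt (hfpos τ0 hτ0) h12 (t3 τ0 (hss hm))⟩
    rcases hcon.eq_or_lt with h | h
    · rw [h] at i1 s4
      linarith
    · have := aux_int_lt hf hfpos s1.le h (hsub _ t2) t3
      linarith
  have hcont : ContinuousOn T (Icc Dm Dp) := by
    intro D0 h0
    obtain ⟨t1, t2, t3, t4⟩ := hT D0 h0
    refine tendsto_order.2 ⟨fun c hc => ?_, fun c hc => ?_⟩
    · rcases le_or_gt c τ0 with hc0 | hc0
      · filter_upwards [self_mem_nhdsWithin] with D hD
        exact hc0.trans_lt (hT D hD).1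
      have hss : Icc τ0 c ⊆ Icc τ0 (T D0) := Icc_subset_Icc_right hc.le
      have hG : ∀ τ ∈ Icc τ0 c, D0 < G f τ := fun τ hτ => t3 τ (hss hτ)
      have hlt := aux_int_lt hf hfpos hc0.le hc (hsub _ t2) t3
      rw [t4] at hlt
      obtain ⟨d, hd, hdG⟩ := aux_gap hf hfpos hc0.le (hss.trans (hsub _ t2)) hG
      have hca := aux_int_cont hf hfpos hc0.le (hss.trans (hsub _ t2)) hG
      have ev := hca.eventually_lt_const hlt
      filter_upwards [self_mem_nhdsWithin, nhdsWithin_le_nhds ev,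
        nhdsWithin_le_nhds (Iio_mem_nhds hd)] with D hD hDL hDd
      by_contra hcon
      push Not at hcon
      obtain ⟨s1, s2, s3, s4⟩ := hT D hD
      rcases hcon.eq_or_lt with h | h
      · rw [h] at s4
        linarith
      · have := aux_int_lt hf hfpos s1.le h (hss.trans (hsub _ t2))
          (fun τ hτ => lt_trans hDd (hdG τ hτ))
        linarith
    · have hTm : T D0 ∈ II aE bE := hsub _ t2 ⟨t1.le, le_rfl⟩
      have hGat : ContinuousAt (G f) (T D0) :=
        (aux_G_contDiff hf hfpos).continuousOn.continuousAt ((aux_isOpen aE bE).mem_nhds hTm)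
      have ev1 : ∀ᶠ τ in 𝓝 (T D0), D0 < G f τ ∧ τ ∈ II aE bE :=
        (hGat.eventually_const_lt (t3 _ ⟨t1.le, le_rfl⟩)).and ((aux_isOpen aE bE).mem_nhds hTm)
      obtain ⟨e, he, hee⟩ := Metric.eventually_nhds_iff.1 ev1
      obtain ⟨c', hc1, hc2⟩ := exists_between (lt_min hc (show T D0 < T D0 + e by linarith))
      have hc3 := hc2.trans_le (min_le_left _ _)
      have hc4 := hc2.trans_le (min_le_right _ _)
      have hloc : ∀ τ, T D0 ≤ τ → τ ≤ c' → D0 < G f τ ∧ τ ∈ II aE bE := fun τ h1 h2 => by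
        apply hee
        rw [Real.dist_eq, abs_of_nonneg (by linarith)]
        linarith
      have hcb : (c' : EReal) < bE := (hloc c' hc1.le le_rfl).2.2
      have hG : ∀ τ ∈ Icc τ0 c', D0 < G f τ := fun τ hτ => by
        rcases le_total τ (T D0) with h | h
        · exact t3 τ ⟨hτ.1, h⟩
        · exact (hloc τ h hτ.2).1
      have h0c : τ0 ≤ c' := (t1.trans hc1).le
      have hlt := aux_int_lt hf hfpos t1.le hc1 (hsub _ hcb) hG
      rw [t4] at hlt
      have ev := (aux_int_cont hf hfpos h0c (hsub _ hcb) hG).eventually_const_lt hlt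
      filter_upwards [self_mem_nhdsWithin, nhdsWithin_le_nhds ev] with D hD hDL
      refine lt_trans ?_ hc3
      by_contra hcon
      push Not at hcon
      obtain ⟨s1, s2, s3, s4⟩ := hT D hD
      rcases hcon.eq_or_lt with h | h
      · rw [← h] at s4
        linarith
      · have := aux_int_lt hf hfpos h0c h (hsub _ s2) s3
        linarith
  refine ⟨T, fun D hD => ⟨hT D hD, huniq D hD⟩, hcont, hanti, fun τ' hτ' => ?_⟩
  obtain ⟨D, hD, rfl⟩ := intermediate_value_Icc' hDmp.le hcont hτ'
  obtain ⟨s1, s2, s3, s4⟩ := hT D hD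
  obtain ⟨s, hs, hss⟩ : ∃ s : ℝ, s ^ 2 = 1 ∧ x0' - x0 = s * |x0' - x0| := by
    rcases le_total 0 (x0' - x0) with h | h
    · exact ⟨1, by norm_num, by rw [abs_of_nonneg h, one_mul]⟩
    · exact ⟨-1, by norm_num, by rw [abs_of_nonpos h]; ring⟩
  exact aux_geod hf hfpos hJo hx0 hx0' hs s1 (hsub _ s2) s3 (by rw [s4]; linarith)
end
end

section
/- Fix τ0 ∈ (a,b) and let m_r := inf{G(τ) : τ ∈ [τ0, b)}. For D ∈ (m_r, G(τ0)) put b_*(D) := inf{τ ∈ (τ0, b) : G(τ) = D} (:= b if this set is empty). Then the function D ↦ ∫_{τ0}^{b_*(D)} f(τ)^{−2} (G(τ) − D)^{−1/2} dτ, with values in (0, ∞], is continuous on the interval (m_r, G(τ0)) with respect to the topology of the extended half-line (0, ∞]. -/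
open Set Filter MeasureTheory Topology
open scoped ENNReal NNReal

noncomputable section

open Set Filter MeasureTheory Topology GRW
open scoped ENNReal

namespace GRW

def IsB (g : ℝ → ℝ) (τ0 D β : ℝ) : Prop :=
  τ0 < β ∧ g β = D ∧ ∀ τ ∈ Ico τ0 β, D < g τ

def kk (g : ℝ → ℝ) (D τ : ℝ) : ℝ≥0∞ := ENNReal.ofReal (g τ * (Real.sqrt (g τ - D))⁻¹)

lemma h_eq_kk (f : ℝ → ℝ) (D τ : ℝ) : h f D τ = kk (G f) D τ := by
  unfold h kk
  rw [mul_inv]; rfl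

lemma exists_isB (g : ℝ → ℝ) (τ0 t D : ℝ) (ht : τ0 ≤ t) (hg : ContinuousOn g (Icc τ0 t))
    (h0 : D < g τ0) (h1 : g t < D) : ∃ β, β ≤ t ∧ IsB g τ0 D β := by
  have hc : IsCompact (Icc τ0 t ∩ g ⁻¹' {D}) :=
    isCompact_Icc.of_isClosed_subset
      (hg.preimage_isClosed_of_isClosed isClosed_Icc isClosed_singleton) inter_subset_left
  obtain ⟨y, hy, hyD⟩ := intermediate_value_Icc' ht hg (show D ∈ Icc (g t) (g τ0) from
    ⟨h1.le, h0.le⟩)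
  obtain ⟨β, ⟨hβ1, hβ2⟩, hleast⟩ := hc.exists_isLeast ⟨y, hy, hyD⟩
  have hβ2 : g β = D := hβ2
  refine ⟨β, hβ1.2, lt_of_le_of_ne hβ1.1 ?_, hβ2, ?_⟩
  · rintro rfl; linarith
  · intro τ hτ
    by_contra hcon
    have hss : Icc τ0 τ ⊆ Icc τ0 t := Icc_subset_Icc_right (hτ.2.le.trans hβ1.2)
    obtain ⟨z, hz, hzD⟩ := intermediate_value_Icc' hτ.1 (hg.mono hss)
      (show D ∈ Icc (g τ) (g τ0) from ⟨not_lt.1 hcon, h0.le⟩)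
    have := hleast ⟨hss hz, hzD⟩
    linarith [hz.2, hτ.2]

lemma kk_aem (g : ℝ → ℝ) (τ0 D β : ℝ) (hg : ContinuousOn g (Icc τ0 β)) (hB : IsB g τ0 D β) :
    ContinuousOn (kk g D) (Ioo τ0 β) := by
  unfold kk
  have hg' := hg.mono Ioo_subset_Icc_self
  refine ENNReal.continuous_ofReal.comp_continuousOn (hg'.mul (ContinuousOn.inv₀ ?_ ?_))
  · exact (hg'.sub continuousOn_const).sqrt
  · intro x hx
    have := hB.2.2 x ⟨hx.1.le, hx.2⟩
    exact (Real.sqrt_pos.2 (by linarith)).ne'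

/-- eventually lower bound for β -/
lemma beta_gt (g : ℝ → ℝ) (τ0 D0 β0 : ℝ) (hg : ContinuousOn g (Icc τ0 β0)) (hB : IsB g τ0 D0 β0)
    (t : ℝ) (ht0 : τ0 ≤ t) (ht : t < β0) :
    ∃ η > 0, (∀ τ ∈ Icc τ0 t, D0 + 2 * η ≤ g τ) ∧
      ∀ D < D0 + 2 * η, ∀ β, IsB g τ0 D β → t < β := by
  obtain ⟨x, hx, hmin⟩ := isCompact_Icc.exists_isMinOn (nonempty_Icc.2 ht0)
    (hg.mono (Icc_subset_Icc_right ht.le))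
  have h1 := hB.2.2 x ⟨hx.1, hx.2.trans_lt ht⟩
  have h2 : ∀ τ ∈ Icc τ0 t, g x ≤ g τ := fun τ hτ => hmin hτ
  refine ⟨(g x - D0) / 2, by linarith, fun τ hτ => by linarith [h2 τ hτ], ?_⟩
  intro D hD β hβ
  by_contra hcon
  have := h2 β ⟨hβ.1.le, not_lt.1 hcon⟩
  rw [hβ.2.1] at this
  linarith

lemma top_case (g : ℝ → ℝ) (U : Set ℝ) (hU : IsOpen U) (τ0 D0 β0 : ℝ)
    (hsub : Icc τ0 β0 ⊆ U) (hg : ContDiffOn ℝ 2 g U) (hD : 0 < D0)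
    (hB : IsB g τ0 D0 β0) (hd : deriv g β0 = 0) :
    ∫⁻ τ in Ioo τ0 β0, kk g D0 τ = ⊤ := by
  have hg1 : ContDiffOn ℝ 1 (deriv g) U := hg.deriv_of_isOpen hU (by norm_num)
  have hg2 : ContinuousOn (deriv (deriv g)) U := hg1.continuousOn_deriv_of_isOpen hU (by norm_num)
  obtain ⟨C, hC⟩ := isCompact_Icc.exists_bound_of_continuousOn (hg2.mono hsub)
  have hdiff1 : ∀ x ∈ U, DifferentiableAt ℝ (deriv g) x := fun x hx =>
    (hg1.differentiableOn (by norm_num)).differentiableAt (hU.mem_nhds hx)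
  have hdiff : ∀ x ∈ U, DifferentiableAt ℝ g x := fun x hx =>
    (hg.differentiableOn (by norm_num)).differentiableAt (hU.mem_nhds hx)
  have hβm : β0 ∈ Icc τ0 β0 := ⟨hB.1.le, le_rfl⟩
  have hC0 : 0 ≤ C := (norm_nonneg _).trans (hC β0 hβm)
  have h1 : ∀ x ∈ Icc τ0 β0, ‖deriv g x‖ ≤ C * (β0 - x) := by
    intro x hx
    have := (convex_Icc τ0 β0).norm_image_sub_le_of_norm_deriv_le
      (fun y hy => hdiff1 y (hsub hy)) hC hβm hx
    rw [hd, sub_zero, Real.norm_eq_abs (x - β0), abs_sub_comm,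
      abs_of_nonneg (by linarith [hx.2])] at this
    exact this
  have h2 : ∀ x ∈ Icc τ0 β0, g x - D0 ≤ C * (β0 - x) ^ 2 := by
    intro x hx
    have hss : Icc x β0 ⊆ Icc τ0 β0 := Icc_subset_Icc_left hx.1
    have := (convex_Icc x β0).norm_image_sub_le_of_norm_deriv_le (C := C * (β0 - x))
      (fun y hy => hdiff y (hsub (hss hy)))
      (fun y hy => (h1 y (hss hy)).trans (by
        apply mul_le_mul_of_nonneg_left _ hC0; linarith [hy.1]))
      (right_mem_Icc.2 hx.2) (left_mem_Icc.2 hx.2)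
    rw [hB.2.1, Real.norm_eq_abs (x - β0), abs_sub_comm x,
      abs_of_nonneg (by linarith [hx.2])] at this
    have := (le_abs_self _).trans this
    nlinarith
  -- lower bound
  set c : ℝ := D0 * (Real.sqrt (C + 1))⁻¹ with hc
  have hs : 0 < Real.sqrt (C + 1) := Real.sqrt_pos.2 (by linarith)
  have hcpos : 0 < c := by positivity
  have h3 : ∀ x ∈ Ioo τ0 β0, ENNReal.ofReal (c * (β0 - x)⁻¹) ≤ kk g D0 x := by
    intro x hx
    have hgx := hB.2.2 x ⟨hx.1.le, hx.2⟩
    have hb : 0 < β0 - x := by linarith [hx.2]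
    apply ENNReal.ofReal_le_ofReal
    have hq : Real.sqrt (g x - D0) ≤ Real.sqrt (C + 1) * (β0 - x) := by
      rw [← Real.sqrt_sq hb.le, ← Real.sqrt_mul (by linarith)]
      apply Real.sqrt_le_sqrt
      have := h2 x ⟨hx.1.le, hx.2.le⟩
      nlinarith [sq_nonneg (β0 - x)]
    have hq0 : 0 < Real.sqrt (g x - D0) := Real.sqrt_pos.2 (by linarith)
    rw [hc, mul_assoc, ← mul_inv]
    apply mul_le_mul hgx.le (inv_anti₀ hq0 hq) (by positivity) (by linarith)
  rw [eq_top_iff]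
  refine le_trans ?_ (setLIntegral_mono' measurableSet_Ioo h3)
  rw [top_le_iff]
  by_contra hne
  have hint : IntegrableOn (fun x => c * (β0 - x)⁻¹) (Ioo τ0 β0) := by
    refine ⟨(by fun_prop : Measurable _).aestronglyMeasurable, ?_⟩
    rw [hasFiniteIntegral_iff_ofReal]
    · exact lt_top_iff_ne_top.2 hne
    · filter_upwards [ae_restrict_mem measurableSet_Ioo] with x hx
      have hb : 0 < β0 - x := by linarith [hx.2]
      show 0 ≤ c * (β0 - x)⁻¹
      positivity
  have hint2 : IntervalIntegrable (fun x => (x - β0)⁻¹) volume τ0 β0 := by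
    rw [intervalIntegrable_iff_integrableOn_Ioo_of_le hB.1.le]
    refine (hint.const_mul (-c⁻¹)).congr (Eventually.of_forall fun x => ?_)
    show -c⁻¹ * (c * (β0 - x)⁻¹) = (x - β0)⁻¹
    rw [← neg_sub x β0, inv_neg]; field_simp
  rw [intervalIntegrable_sub_inv_iff] at hint2
  rcases hint2 with h | h
  · exact hB.1.ne h
  · exact h right_mem_uIcc

lemma kk_tendsto (g : ℝ → ℝ) (D t : ℕ → ℝ) (D0 t0 : ℝ) (hD : Tendsto D atTop (𝓝 D0))
    (ht : Tendsto t atTop (𝓝 t0)) (hg : ContinuousAt g t0) (h : D0 < g t0) :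
    Tendsto (fun n => kk g (D n) (t n)) atTop (𝓝 (kk g D0 t0)) := by
  unfold kk
  refine (ENNReal.continuous_ofReal.tendsto _).comp ?_
  have hgt : Tendsto (fun n => g (t n)) atTop (𝓝 (g t0)) := hg.tendsto.comp ht
  refine hgt.mul (Tendsto.inv₀ ?_ (Real.sqrt_pos.2 (by linarith)).ne')
  exact (Real.continuous_sqrt.tendsto _).comp (hgt.sub hD)

lemma fatou_case (g : ℝ → ℝ) (U : Set ℝ) (hU : IsOpen U) (τ0 D0 β0 : ℝ)
    (hsub : Icc τ0 β0 ⊆ U) (hg : ContinuousOn g U) (hB : IsB g τ0 D0 β0)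
    (D β : ℕ → ℝ) (hD : Tendsto D atTop (𝓝 D0)) (hBn : ∀ n, IsB g τ0 (D n) (β n))
    (hsubn : ∀ n, Icc τ0 (β n) ⊆ U) :
    ∫⁻ τ in Ioo τ0 β0, kk g D0 τ ≤ liminf (fun n => ∫⁻ τ in Ioo τ0 (β n), kk g (D n) τ) atTop := by
  simp_rw [← lintegral_indicator measurableSet_Ioo]
  refine le_trans (lintegral_mono fun τ => ?_) (lintegral_liminf_le' fun n => ?_)
  · by_cases hτ : τ ∈ Ioo τ0 β0
    swap
    · rw [indicator_of_notMem hτ]; exact bot_le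
    rw [indicator_of_mem hτ]
    obtain ⟨η, hη, -, h2⟩ := beta_gt g τ0 D0 β0 (hg.mono hsub) hB τ hτ.1.le hτ.2
    have ht := kk_tendsto g D (fun _ => τ) D0 τ hD tendsto_const_nhds
      (hg.continuousAt (hU.mem_nhds (hsub ⟨hτ.1.le, hτ.2.le⟩)))
      (hB.2.2 τ ⟨hτ.1.le, hτ.2⟩)
    rw [← ht.liminf_eq]
    apply le_of_eq
    apply liminf_congr
    filter_upwards [hD.eventually_lt_const (show D0 < D0 + 2 * η by linarith)] with n hn
    rw [indicator_of_mem]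
    exact ⟨hτ.1, h2 _ hn _ (hBn n)⟩
  · rw [aemeasurable_indicator_iff measurableSet_Ioo]
    exact (kk_aem g τ0 _ _ (hg.mono (hsubn n)) (hBn n)).aemeasurable measurableSet_Ioo

lemma dom_case (g : ℝ → ℝ) (U : Set ℝ) (hU : IsOpen U) (τ0 D0 β0 : ℝ)
    (hsub : Icc τ0 β0 ⊆ U) (hg : ContDiffOn ℝ 2 g U) (hpos : ∀ x ∈ U, 0 < g x)
    (hB : IsB g τ0 D0 β0) (hd : deriv g β0 < 0)
    (D β : ℕ → ℝ) (hD : Tendsto D atTop (𝓝 D0)) (hBn : ∀ n, IsB g τ0 (D n) (β n))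
    (hsubn : ∀ n, Icc τ0 (β n) ⊆ U) :
    Tendsto (fun n => ∫⁻ τ in Ioo τ0 (β n), kk g (D n) τ) atTop
      (𝓝 (∫⁻ τ in Ioo τ0 β0, kk g D0 τ)) := by
  have hgc : ContinuousOn g U := hg.continuousOn
  have hg1 : ContinuousOn (deriv g) U := hg.continuousOn_deriv_of_isOpen hU (by norm_num)
  have hdiff : DifferentiableOn ℝ g U := hg.differentiableOn (by norm_num)
  have hβU : β0 ∈ U := hsub ⟨hB.1.le, le_rfl⟩
  obtain ⟨c, hc0, hc⟩ : ∃ c > 0, deriv g β0 < -c := ⟨-(deriv g β0) / 2, by linarith, by linarith⟩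
  have hev : ∀ᶠ x in 𝓝 β0, x ∈ U ∧ deriv g x < -c ∧ τ0 < x :=
    (hU.eventually_mem hβU).and (((hg1.continuousAt (hU.mem_nhds hβU)).eventually_lt_const hc).and
      (lt_mem_nhds hB.1))
  obtain ⟨δ', hδ', hball⟩ := Metric.eventually_nhds_iff.1 hev
  obtain ⟨δ, hδ, hδlt⟩ : ∃ δ, 0 < δ ∧ δ < δ' := ⟨δ' / 2, by linarith, by linarith⟩
  have hI : ∀ x ∈ Icc (β0 - δ) (β0 + δ), x ∈ U ∧ deriv g x < -c ∧ τ0 < x := by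
    intro x hx
    apply hball
    rw [Real.dist_eq, abs_lt]
    constructor <;> linarith [hx.1, hx.2]
  have hmvt : ∀ x ∈ Icc (β0 - δ) (β0 + δ), ∀ y ∈ Icc (β0 - δ) (β0 + δ), x ≤ y →
      g y - g x ≤ -c * (y - x) := by
    apply (convex_Icc _ _).image_sub_le_mul_sub_of_deriv_le
    · exact hgc.mono fun x hx => (hI x hx).1
    · exact hdiff.mono fun x hx => (hI x (interior_subset hx)).1
    · exact fun x hx => (hI x (interior_subset hx)).2.1.le
  -- convergence of β
  have hup : ∀ ε, 0 < ε → ε ≤ δ → ∀ᶠ n in atTop, β n < β0 + ε := by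
    intro ε hε hεδ
    have h1 := hmvt β0 ⟨by linarith, by linarith⟩ (β0 + ε) ⟨by linarith, by linarith⟩ (by linarith)
    rw [hB.2.1] at h1
    have hlt : g (β0 + ε) < D0 := by nlinarith [mul_pos hc0 hε]
    filter_upwards [hD.eventually_const_lt hlt] with n hn
    by_contra hcon
    rcases (not_lt.1 hcon).eq_or_lt with h | h
    · have := (hBn n).2.1
      rw [← h] at this; linarith
    · have := (hBn n).2.2 (β0 + ε) ⟨by linarith [hB.1], h⟩
      linarith
  have hlow : ∀ ε, 0 < ε → ε ≤ δ → ∀ᶠ n in atTop, β0 - ε < β n := by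
    intro ε hε hεδ
    obtain ⟨η, hη, -, h2⟩ := beta_gt g τ0 D0 β0 (hgc.mono hsub) hB (β0 - ε)
      (hI (β0 - ε) ⟨by linarith, by linarith⟩).2.2.le (by linarith)
    filter_upwards [hD.eventually_lt_const (show D0 < D0 + 2 * η by linarith)] with n hn
    exact h2 _ hn _ (hBn n)
  have hβ : Tendsto β atTop (𝓝 β0) := by
    rw [Metric.tendsto_nhds]
    intro ε hε
    filter_upwards [hup (min ε δ) (lt_min hε hδ) (min_le_right _ _),
      hlow (min ε δ) (lt_min hε hδ) (min_le_right _ _)] with n h1 h2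
    rw [Real.dist_eq, abs_lt]
    constructor <;> linarith [min_le_left ε δ]
  -- uniform lower bound
  have hsubδ : Icc τ0 (β0 + δ) ⊆ U := by
    intro x hx
    rcases le_total x β0 with h | h
    · exact hsub ⟨hx.1, h⟩
    · exact (hI x ⟨by linarith, hx.2⟩).1
  obtain ⟨M, hM⟩ := isCompact_Icc.exists_bound_of_continuousOn (hgc.mono hsubδ)
  have hM0 : 0 ≤ M := (norm_nonneg _).trans (hM τ0 ⟨le_rfl, by linarith [hB.1]⟩)
  have hL0 : 0 < β0 + δ - τ0 := by linarith [hB.1]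
  obtain ⟨k, hk0, hk⟩ : ∃ k > 0, ∀ᶠ n in atTop, β n < β0 + δ ∧
      ∀ τ ∈ Ioo τ0 (β n), k * (β n - τ) ≤ g τ - D n := by
    obtain ⟨η, hη, h1, h2⟩ := beta_gt g τ0 D0 β0 (hgc.mono hsub) hB (β0 - δ)
      (hI (β0 - δ) ⟨by linarith, by linarith⟩).2.2.le (by linarith)
    refine ⟨min c (η / (β0 + δ - τ0)), lt_min hc0 (by positivity), ?_⟩
    filter_upwards [hD.eventually_lt_const (show D0 < D0 + η by linarith), hup δ hδ le_rfl,
      hlow δ hδ le_rfl] with n hn hu hl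
    refine ⟨hu, fun τ hτ => ?_⟩
    have hbτ : 0 < β n - τ := by linarith [hτ.2]
    rcases le_total τ (β0 - δ) with h | h
    · have e1 := h1 τ ⟨hτ.1.le, h⟩
      calc _ ≤ η / (β0 + δ - τ0) * (β0 + δ - τ0) := by
            apply mul_le_mul (min_le_right _ _) _ hbτ.le (by positivity)
            linarith [hτ.1]
        _ = η := by field_simp
        _ ≤ _ := by linarith
    · have e1 := hmvt τ ⟨h, by linarith [hτ.2]⟩ (β n) ⟨hl.le, hu.le⟩ hτ.2.le
      rw [(hBn n).2.1] at e1
      have := mul_le_mul_of_nonneg_right (min_le_left c (η / (β0 + δ - τ0))) hbτ.le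
      linarith
  obtain ⟨N, hN⟩ := eventually_atTop.1 hk
  rw [← tendsto_add_atTop_iff_nat N]
  simp_rw [← lintegral_indicator measurableSet_Ioo]
  have hshift : ∀ D β : ℝ, ∫⁻ τ, (Ioo τ0 β).indicator (kk g D) τ =
      ∫⁻ s, (Ioo τ0 β).indicator (kk g D) (β - s) := fun D β =>
    (lintegral_sub_left_eq_self (μ := volume) (fun τ => (Ioo τ0 β).indicator (kk g D) τ) β).symm
  have e1 : ∀ D β : ℝ, ∫⁻ τ, (Ioo τ0 β).indicator (fun τ => kk g D τ) τ =
      ∫⁻ s, (Ioo τ0 β).indicator (kk g D) (β - s) := hshift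
  simp_rw [e1]
  refine tendsto_lintegral_of_dominated_convergence'
    ((Ioo 0 (β0 + δ - τ0)).indicator
      fun s => ENNReal.ofReal (M * (Real.sqrt k)⁻¹ * s ^ (-(1/2) : ℝ))) ?_ ?_ ?_ ?_
  · intro n
    have : AEMeasurable ((Ioo τ0 (β (n+N))).indicator (kk g (D (n+N)))) volume := by
      rw [aemeasurable_indicator_iff measurableSet_Ioo]
      exact (kk_aem g τ0 _ _ (hgc.mono (hsubn _)) (hBn _)).aemeasurable measurableSet_Ioo
    exact this.comp_quasiMeasurePreserving
      (Measure.measurePreserving_sub_left volume (β (n+N))).quasiMeasurePreserving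
  · intro n
    refine Eventually.of_forall fun s => ?_
    obtain ⟨hu, hb⟩ := hN (n + N) (Nat.le_add_left _ _)
    show (Ioo τ0 (β (n+N))).indicator (kk g (D (n+N))) (β (n+N) - s) ≤ _
    by_cases hs : β (n+N) - s ∈ Ioo τ0 (β (n+N))
    swap
    · rw [indicator_of_notMem hs]; exact bot_le
    have hs0 : 0 < s := by linarith [hs.2]
    rw [indicator_of_mem hs, indicator_of_mem (show s ∈ Ioo 0 (β0 + δ - τ0) from
      ⟨hs0, by linarith [hs.1]⟩)]
    have hb1 := hb _ hs
    rw [sub_sub_cancel] at hb1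
    have hgM := (le_abs_self _).trans (hM (β (n+N) - s) ⟨hs.1.le, by linarith⟩)
    apply ENNReal.ofReal_le_ofReal
    rw [mul_assoc]
    have hr : s ^ (-(1/2) : ℝ) = (Real.sqrt s)⁻¹ := by
      rw [Real.rpow_neg hs0.le, Real.sqrt_eq_rpow]
    rw [hr, ← mul_inv, ← Real.sqrt_mul hk0.le]
    apply mul_le_mul hgM _ (by positivity) hM0
    exact inv_anti₀ (Real.sqrt_pos.2 (by positivity)) (Real.sqrt_le_sqrt hb1)
  · rw [lintegral_indicator measurableSet_Ioo]
    have : IntegrableOn (fun s : ℝ => M * (Real.sqrt k)⁻¹ * s ^ (-(1/2) : ℝ))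
        (Ioo 0 (β0 + δ - τ0)) := by
      have h1 := intervalIntegral.intervalIntegrable_rpow' (a := 0) (b := β0 + δ - τ0)
        (r := (-(1/2) : ℝ)) (by norm_num)
      rw [intervalIntegrable_iff_integrableOn_Ioo_of_le hL0.le] at h1
      exact h1.const_mul _
    exact this.lintegral_lt_top.ne
  · have hae : ∀ᵐ s : ℝ, s ≠ β0 - τ0 ∧ s ≠ 0 :=
      (Measure.ae_ne volume _).and (Measure.ae_ne volume _)
    filter_upwards [hae] with s hs
    rw [← tendsto_add_atTop_iff_nat N] at hβ hD
    have hbs := hβ.sub_const s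
    by_cases hm : β0 - s ∈ Ioo τ0 β0
    · rw [indicator_of_mem hm]
      refine (kk_tendsto g _ _ D0 (β0 - s) hD hbs
        (hgc.continuousAt (hU.mem_nhds (hsub ⟨hm.1.le, hm.2.le⟩)))
        (hB.2.2 _ ⟨hm.1.le, hm.2⟩)).congr' ?_
      filter_upwards [hbs.eventually_const_lt hm.1] with n hn
      rw [indicator_of_mem]
      exact ⟨hn, by linarith [hm.2]⟩
    · rw [indicator_of_notMem hm]
      refine tendsto_const_nhds.congr' ?_
      by_cases h0 : s ≤ 0
      · refine Eventually.of_forall fun n => ?_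
        show 0 = (Ioo τ0 (β (n + N))).indicator (kk g (D (n + N))) (β (n + N) - s)
        rw [indicator_of_notMem]
        exact fun h => by linarith [h.2]
      · have : β0 - s < τ0 := by
          rcases lt_trichotomy (β0 - s) τ0 with h | h | h
          · exact h
          · exact absurd (by linarith) hs.1
          · exact absurd ⟨h, by linarith⟩ hm
        filter_upwards [hbs.eventually_lt_const this] with n hn
        rw [indicator_of_notMem]
        exact fun h => by linarith [h.1]

lemma bstar_eq (bE : EReal) (f : ℝ → ℝ) (τ0 D β : ℝ) (hb : (β : EReal) < bE)
    (hB : IsB (G f) τ0 D β) : bstar bE f τ0 D = β := by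
  unfold bstar
  apply le_antisymm
  · exact sInf_le (Or.inr ⟨β, ⟨hB.1, hb, hB.2.1⟩, rfl⟩)
  · apply le_sInf
    rintro _ (rfl | ⟨t, ⟨h1, -, h3⟩, rfl⟩)
    · exact hb.le
    · show (β : EReal) ≤ (t : EReal)
      rw [EReal.coe_le_coe_iff]
      by_contra hcon
      have := hB.2.2 t ⟨h1.le, not_le.1 hcon⟩
      linarith

end GRW

/-- Fix `τ0 ∈ (a,b)` and let `m_r = inf {G(τ) : τ ∈ [τ0,b)}`. With
`b_*(D) = inf {τ ∈ (τ0,b) : G(τ) = D}` (defaulting to `b`), the function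
`D ↦ ∫_{τ0}^{b_*(D)} f⁻²(G−D)^{-1/2}`, valued in `(0,∞]`, is continuous on
`(m_r, G(τ0))` (for the topology of the extended half-line). -/
theorem integral_to_bstar_continuous
    (aE bE : EReal) (hab : aE < bE) (f : ℝ → ℝ)
    (hf : ContDiffOn ℝ (⊤ : ℕ∞) f (II aE bE)) (hfpos : ∀ τ ∈ II aE bE, 0 < f τ)
    (τ0 : ℝ) (hτ0 : τ0 ∈ II aE bE) :
    (∀ D ∈ Ioo (sInf (G f '' {τ : ℝ | τ0 ≤ τ ∧ (τ : EReal) < bE})) (G f τ0),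
      0 < ∫⁻ τ in {τ : ℝ | τ0 < τ ∧ (τ : EReal) < bstar bE f τ0 D}, h f D τ) ∧
    ContinuousOn
      (fun D : ℝ => ∫⁻ τ in {τ : ℝ | τ0 < τ ∧ (τ : EReal) < bstar bE f τ0 D}, h f D τ)
      (Ioo (sInf (G f '' {τ : ℝ | τ0 ≤ τ ∧ (τ : EReal) < bE})) (G f τ0)) := by
  have hUo : IsOpen (II aE bE) :=
    (isOpen_lt continuous_const continuous_coe_real_ereal).inter
      (isOpen_lt continuous_coe_real_ereal continuous_const)
  have hsub : ∀ t : ℝ, (t : EReal) < bE → Icc τ0 t ⊆ II aE bE := by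
    intro t ht x hx
    exact ⟨lt_of_lt_of_le hτ0.1 (EReal.coe_le_coe_iff.2 hx.1),
      lt_of_le_of_lt (EReal.coe_le_coe_iff.2 hx.2) ht⟩
  have hg : ContDiffOn ℝ 2 (G f) (II aE bE) := by
    have h2 : ContDiffOn ℝ 2 f (II aE bE) := hf.of_le (WithTop.coe_le_coe.2 (le_top : (2 : ℕ∞) ≤ ⊤))
    exact (h2.pow 2).inv fun x hx => (pow_pos (hfpos x hx) 2).ne'
  have hpos : ∀ x ∈ II aE bE, 0 < G f x := fun x hx => inv_pos.2 (pow_pos (hfpos x hx) 2)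
  have hex : ∀ D ∈ Ioo (sInf (G f '' {τ : ℝ | τ0 ≤ τ ∧ (τ : EReal) < bE})) (G f τ0),
      ∃ β : ℝ, (β : EReal) < bE ∧ IsB (G f) τ0 D β := by
    intro D hD
    obtain ⟨_, ⟨t, ⟨ht1, ht2⟩, rfl⟩, htD⟩ := exists_lt_of_csInf_lt
      ⟨_, mem_image_of_mem (G f) (show τ0 ∈ {τ : ℝ | τ0 ≤ τ ∧ (τ : EReal) < bE} from
        ⟨le_rfl, hτ0.2⟩)⟩ hD.1
    obtain ⟨β, h1, h2⟩ := exists_isB (G f) τ0 t D ht1 (hg.continuousOn.mono (hsub t ht2)) hD.2 htD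
    exact ⟨β, lt_of_le_of_lt (EReal.coe_le_coe_iff.2 h1) ht2, h2⟩
  choose! b hb using hex
  have hset : ∀ D ∈ Ioo (sInf (G f '' {τ : ℝ | τ0 ≤ τ ∧ (τ : EReal) < bE})) (G f τ0),
      ∫⁻ τ in {τ : ℝ | τ0 < τ ∧ (τ : EReal) < bstar bE f τ0 D}, h f D τ
        = ∫⁻ τ in Ioo τ0 (b D), kk (G f) D τ := by
    intro D hD
    rw [bstar_eq bE f τ0 D (b D) (hb D hD).1 (hb D hD).2]
    simp_rw [h_eq_kk, EReal.coe_lt_coe_iff]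
    rfl
  constructor
  · intro D hD
    rw [hset D hD]
    obtain ⟨hb1, hb2⟩ := hb D hD
    have hc := kk_aem (G f) τ0 D (b D) (hg.continuousOn.mono (hsub _ hb1)) hb2
    rw [pos_iff_ne_zero]
    intro h0
    rw [lintegral_eq_zero_iff' (hc.aemeasurable measurableSet_Ioo)] at h0
    have hF : ∀ᵐ x ∂(volume.restrict (Ioo τ0 (b D))), False := by
      filter_upwards [h0, ae_restrict_mem measurableSet_Ioo] with x hx hxm
      have h1 := hb2.2.2 x ⟨hxm.1.le, hxm.2⟩
      have h2 := hpos x (hsub _ hb1 ⟨hxm.1.le, hxm.2.le⟩)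
      have h3 : 0 < Real.sqrt (G f x - D) := Real.sqrt_pos.2 (by linarith)
      have h4 : kk (G f) D x = 0 := hx
      unfold kk at h4
      rw [ENNReal.ofReal_eq_zero] at h4
      have : 0 < G f x * (Real.sqrt (G f x - D))⁻¹ := by positivity
      linarith
    rw [ae_iff] at hF
    simp only [not_false_eq_true, setOf_true, Measure.restrict_apply_univ, Real.volume_Ioo,
      ENNReal.ofReal_eq_zero] at hF
    linarith [hb2.1]
  · refine ContinuousOn.congr ?_ hset
    intro D0 hD0
    have hD0pos : 0 < D0 := by
      refine lt_of_le_of_lt (Real.sInf_nonneg ?_) hD0.1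
      rintro _ ⟨t, ht, rfl⟩
      exact (hpos t (hsub t ht.2 ⟨ht.1, le_rfl⟩)).le
    have hnw : 𝓝[Ioo (sInf (G f '' {τ : ℝ | τ0 ≤ τ ∧ (τ : EReal) < bE})) (G f τ0)] D0 = 𝓝 D0 :=
      isOpen_Ioo.nhdsWithin_eq hD0
    rw [ContinuousWithinAt, hnw]
    obtain ⟨hb1, hb2⟩ := hb D0 hD0
    apply tendsto_of_seq_tendsto
    intro x hx
    obtain ⟨N, hN⟩ := eventually_atTop.1 (hx.eventually (isOpen_Ioo.mem_nhds hD0))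
    rw [← tendsto_add_atTop_iff_nat N] at hx ⊢
    have hxm : ∀ n, x (n + N) ∈ Ioo (sInf (G f '' {τ : ℝ | τ0 ≤ τ ∧ (τ : EReal) < bE})) (G f τ0) :=
      fun n => hN _ (Nat.le_add_left _ _)
    have hβU : b D0 ∈ II aE bE := hsub _ hb1 ⟨hb2.1.le, le_rfl⟩
    rcases lt_trichotomy (deriv (G f) (b D0)) 0 with hd | hd | hd
    · exact dom_case (G f) _ hUo τ0 D0 (b D0) (hsub _ hb1) hg hpos hb2 hd (fun n => x (n + N))
        (fun n => b (x (n + N))) hx (fun n => (hb _ (hxm n)).2)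
        (fun n => hsub _ (hb _ (hxm n)).1)
    · have h1 := fatou_case (G f) _ hUo τ0 D0 (b D0) (hsub _ hb1) hg.continuousOn hb2
        (fun n => x (n + N)) (fun n => b (x (n + N))) hx (fun n => (hb _ (hxm n)).2)
        (fun n => hsub _ (hb _ (hxm n)).1)
      have h2 := top_case (G f) _ hUo τ0 D0 (b D0) (hsub _ hb1) hg hD0pos hb2 hd
      show Tendsto _ _ (𝓝 (∫⁻ τ in Ioo τ0 (b D0), kk (G f) D0 τ))
      exact tendsto_of_le_liminf_of_limsup_le h1 (by rw [h2]; exact le_top)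
    · exfalso
      have hda : DifferentiableAt ℝ (G f) (b D0) :=
        (hg.differentiableOn (by norm_num)).differentiableAt (hUo.mem_nhds hβU)
      have hs := hasDerivAt_iff_tendsto_slope_left_right.1 hda.hasDerivAt
      have h1 := (hs.1.eventually_const_lt hd).and
        (Ioo_mem_nhdsLT hb2.1)
      obtain ⟨y, hy1, hy2⟩ := h1.exists
      have h3 := hb2.2.2 y ⟨hy2.1.le, hy2.2⟩
      rw [slope_def_field, hb2.2.1] at hy1
      have : (G f y - D0) / (y - b D0) ≤ 0 :=
        div_nonpos_of_nonneg_of_nonpos (by linarith) (by linarith [hy2.2])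
      linarith
end
end
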